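/- For every ε > 0 there is a constant C(ε) > 0 such that for every finite non-empty set A of points on the unit sphere 𝒮_{3,1} = {x ∈ ℝ³ : x_1² + x_2² + x_3² = 1}, the additive energy satisfies E_{2,2}(A) ≤ C(ε) · |A|^{2 + 2/9 + ε}. -/

import Mathlib

open Finset

noncomputable section


/-- The sphere `𝒮_{d,λ}` of points `x ∈ ℝ^d` with `x₁² + ⋯ + x_d² = λ`. -/
def realSphere (d : ℕ) (lam : ℝ) : Set (Fin d → ℝ) := {x | ∑ i, x i ^ 2 = lam}

/-- The additive energy `E_{2,2}(A)`: the number of 4-tuples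
`(x₁, x₂, x₃, x₄) ∈ A⁴` with `x₁ + x₂ = x₃ + x₄`. -/
def addEnergy {V : Type*} [AddCommMonoid V] (s : ℕ) (A : Set V) : ℕ :=
  Nat.card {p : (Fin s → V) × (Fin s → V) //
    (∀ i, p.1 i ∈ A) ∧ (∀ i, p.2 i ∈ A) ∧ ∑ i, p.1 i = ∑ i, p.2 i}


theorem image_card_changes {β : Type*} [DecidableEq β] (f : ℕ → β) (L : ℕ) :
    ((range (L+1)).image f).card ≤ 1 + ((range L).filter (fun k => f k ≠ f (k+1))).card := by
  induction L with
  | zero => simp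
  | succ L ih =>
    rw [range_add_one (n := L+1), image_insert, range_add_one (n := L), filter_insert]
    split_ifs with h
    · rw [card_insert_of_notMem (s := (range L).filter (fun k => f k ≠ f (k+1))) (by simp)]
      have := card_insert_le (f (L+1)) ((range (L+1)).image f)
      rw [range_add_one (n := L)] at this ih
      omega
    · push Not at h
      rw [insert_eq_of_mem]
      · rw [range_add_one (n := L)] at ih; exact ih
      · rw [← h]; simp

theorem mono_changes (f : ℕ → ℕ) (hf : Monotone f) (L : ℕ) :
    ((range L).filter (fun k => f k ≠ f (k+1))).card ≤ f L := by
  induction L with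
  | zero => simp
  | succ L ih =>
    rw [range_add_one, filter_insert]
    have := hf (Nat.le_succ L)
    split_ifs with h
    · rw [card_insert_of_notMem (by simp)]
      simp only [Nat.succ_eq_add_one] at this
      omega
    · exact ih.trans this

theorem hermite_sum (w l : ℕ) (hw : 0 < w) : ∑ j ∈ range w, (l + j) / w = l := by
  induction l with
  | zero =>
    apply sum_eq_zero
    intro j hj
    simp at hj
    simp [Nat.div_eq_of_lt hj]
  | succ l ih =>
    have h1 := sum_range_succ (fun j => (l + j) / w) w
    have h2 := sum_range_succ' (fun j => (l + j) / w) w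
    have h3 : (l + w) / w = l / w + 1 := Nat.add_div_right l hw
    have h4 : ∑ j ∈ range w, (l + 1 + j) / w = ∑ j ∈ range w, (l + (j+1)) / w :=
      sum_congr rfl (fun j _ => by congr 1; ring)
    simp only [add_zero] at h2
    omega

theorem bucket_shift_aux (w l l' : ℕ) (hw : 0 < w) (h : l ≤ l') :
    ((range w).filter (fun j => (l + j) / w ≠ (l' + j) / w)).card ≤ l' - l := by
  have h1 := hermite_sum w l hw
  have h2 := hermite_sum w l' hw
  have h3 : ∑ j ∈ range w, (l + j) / w + ((range w).filter (fun j => (l + j) / w ≠ (l' + j) / w)).card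
      ≤ ∑ j ∈ range w, (l' + j) / w := by
    rw [card_filter, ← sum_add_distrib]
    apply sum_le_sum
    intro j _
    have : (l + j) / w ≤ (l' + j) / w := Nat.div_le_div_right (by omega)
    split_ifs <;> omega
  omega

theorem bucket_shift (w l l' : ℕ) (hw : 0 < w) :
    ((range w).filter (fun j => (l + j) / w ≠ (l' + j) / w)).card ≤ (l' - l) + (l - l') := by
  rcases le_total l l' with h | h
  · have := bucket_shift_aux w l l' hw h; omega
  · have := bucket_shift_aux w l' l hw h
    have e : ((range w).filter (fun j => (l + j) / w ≠ (l' + j) / w)) = ((range w).filter (fun j => (l' + j) / w ≠ (l + j) / w)) := by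
      apply filter_congr; intro j _; exact ne_comm
    rw [e]
    omega

open Classical in
theorem lev_change {Γ : Type*} [Fintype Γ] (P Q : Γ → Prop) :
    ((univ.filter Q).card - (univ.filter P).card) + ((univ.filter P).card - (univ.filter Q).card)
      ≤ (univ.filter (fun c => ¬ (P c ↔ Q c))).card := by
  have h1 : (univ.filter Q).card ≤ (univ.filter P).card + (univ.filter (fun c => ¬ (P c ↔ Q c))).card := by
    rw [← card_union_add_card_inter]
    refine le_trans (card_le_card ?_) (Nat.le_add_right _ _)
    intro c; simp; tauto
  have h2 : (univ.filter P).card ≤ (univ.filter Q).card + (univ.filter (fun c => ¬ (P c ↔ Q c))).card := by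
    rw [← card_union_add_card_inter]
    refine le_trans (card_le_card ?_) (Nat.le_add_right _ _)
    intro c; simp; tauto
  omega

open Classical in
theorem cutting {Γ : Type*} [Fintype Γ] (n K1 K2 w s : ℕ) (hw : 0 < w) (hs : 0 < s)
    (on : Γ → ℕ → Prop) (lt : Γ → Γ → ℕ → Prop) (lev : Γ → ℕ → ℕ)
    (hlev : ∀ c k, lev c k = (univ.filter (fun c' => lt c' c k)).card) (l : ℕ → ℕ)
    (H1 : ∀ c, ((range (2*n)).filter (fun k => ¬ (on c k ↔ on c (k+1)))).card ≤ K1)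
    (H2 : ∀ c c', ((range (2*n)).filter (fun k => on c k ∧ on c (k+1) ∧
      ¬ (lt c' c k ↔ lt c' c (k+1)))).card ≤ K2)
    (H3 : ∀ k c c', Even k → on c k → on c' k → lev c k = lev c' k → c = c') :
    ∃ cell : ℕ → ℕ × ℕ, (∀ key, ((range n).filter (fun i => cell i = key)).card ≤ s) ∧
      w * ∑ c, (((range n).filter (fun i => on c (2*i+1) ∧ lev c (2*i+1) = l i)).image cell).card
        ≤ w * (Fintype.card Γ * (1 + K1) + (n / s) * w) + K2 * Fintype.card Γ ^ 2 := by
  let M := Fintype.card Γ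
  let S2 : ℕ → Γ → Finset ℕ := fun j c => (range (2*n)).filter (fun k => on c k ∧ on c (k+1) ∧
    (lev c k + j) / w ≠ (lev c (k+1) + j) / w)
  have hsum : ∑ j ∈ range w, ∑ c, (S2 j c).card ≤ K2 * M ^ 2 := by
    rw [sum_comm]
    have : ∀ c, ∑ j ∈ range w, (S2 j c).card ≤ K2 * M := by
      intro c
      calc ∑ j ∈ range w, (S2 j c).card
          = ∑ k ∈ (range (2*n)).filter (fun k => on c k ∧ on c (k+1)),
              ((range w).filter (fun j => (lev c k + j) / w ≠ (lev c (k+1) + j) / w)).card := by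
            simp only [S2, card_filter, sum_filter]
            rw [sum_comm]
            apply sum_congr rfl
            intro k _
            split_ifs with h
            · simp [h.1, h.2]
            · apply sum_eq_zero; intro j _
              rw [if_neg]; tauto
        _ ≤ ∑ k ∈ (range (2*n)).filter (fun k => on c k ∧ on c (k+1)),
              (univ.filter (fun c' => ¬ (lt c' c k ↔ lt c' c (k+1)))).card := by
            apply sum_le_sum
            intro k _
            refine (bucket_shift w _ _ hw).trans ?_
            rw [hlev, hlev]
            exact lev_change _ _
        _ = ∑ c', ((range (2*n)).filter (fun k => on c k ∧ on c (k+1) ∧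
              ¬ (lt c' c k ↔ lt c' c (k+1)))).card := by
            simp only [card_filter, sum_filter]
            rw [sum_comm]
            apply sum_congr rfl
            intro k _
            split_ifs with h
            · simp [h.1, h.2]
            · symm; apply sum_eq_zero; intro j _
              rw [if_neg]; tauto
        _ ≤ ∑ c' : Γ, K2 := sum_le_sum (fun c' _ => H2 c c')
        _ = K2 * M := by simp [M, mul_comm]
    calc _ ≤ ∑ c : Γ, K2 * M := sum_le_sum (fun c _ => this c)
      _ = K2 * M ^ 2 := by simp [M]; ring
  obtain ⟨j, hj, hjle⟩ : ∃ j ∈ range w, w * ∑ c, (S2 j c).card ≤ K2 * M ^ 2 := by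
    by_contra! hcon
    have h1 : ∑ j ∈ range w, K2 * M ^ 2 < ∑ j ∈ range w, w * ∑ c, (S2 j c).card :=
      sum_lt_sum_of_nonempty (by simpa using hw.ne') hcon
    rw [← mul_sum (f := fun j => ∑ c, (S2 j c).card), sum_const, card_range, smul_eq_mul] at h1
    have := Nat.lt_of_mul_lt_mul_left h1
    omega
  let b : ℕ → ℕ := fun x => (x + j) / w
  let cnt : ℕ → ℕ → ℕ := fun β k => ((range n).filter (fun i => 2*i+1 < k ∧ b (l i) = β)).card
  have cnt_mono : ∀ β, Monotone (cnt β) := by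
    intro β k k' h
    apply card_le_card
    intro i; simp only [mem_filter]
    rintro ⟨h1, h2, h3⟩; exact ⟨h1, by omega, h3⟩
  let cell : ℕ → ℕ × ℕ := fun i => (b (l i), cnt (b (l i)) (2*i+1) / s)
  refine ⟨cell, ?_, ?_⟩
  · rintro ⟨β, q⟩
    calc ((range n).filter (fun i => cell i = (β, q))).card ≤ (Finset.Ico (q*s) (q*s+s)).card := by
          apply card_le_card_of_injOn (fun i => cnt β (2*i+1))
          · intro i hi
            simp only [coe_filter, mem_range, Set.mem_ofPred_eq, cell, Prod.mk.injEq] at hi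
            obtain ⟨_, hb, hq⟩ := hi
            rw [hb] at hq
            simp only [coe_Ico, Set.mem_Ico]
            rw [Nat.div_eq_iff hs] at hq
            have := hq.2
            constructor
            · nlinarith [hq.1]
            · have := hq.2; omega
          · have key : ∀ i i', i < i' → i < n → b (l i) = β → cnt β (2*i+1) < cnt β (2*i'+1) := by
              intro i i' h hi hb
              apply card_lt_card
              rw [ssubset_iff_of_subset]
              · refine ⟨i, ?_, ?_⟩
                · simp; exact ⟨hi, by omega, hb⟩
                · simp
              · intro x; simp only [mem_filter]; rintro ⟨h1, h2, h3⟩; exact ⟨h1, by omega, h3⟩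
            intro i hi i' hi' he
            simp only [coe_filter, mem_range, Set.mem_ofPred_eq, cell, Prod.mk.injEq] at hi hi'
            rcases lt_trichotomy i i' with h | h | h
            · exact absurd he (key _ _ h hi.1 hi.2.1).ne
            · exact h
            · exact absurd he (key _ _ h hi'.1 hi'.2.1).ne'
      _ = s := by simp
  let S1 : Γ → Finset ℕ := fun c => (range (2*n)).filter (fun k => ¬ (on c k ↔ on c (k+1)))
  let S3 : Γ → Finset ℕ := fun c => (range (2*n)).filter (fun k => on c (k+1) ∧
    cnt (b (lev c (k+1))) k / s ≠ cnt (b (lev c (k+1))) (k+1) / s)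
  have hc : ∀ c, (((range n).filter (fun i => on c (2*i+1) ∧ lev c (2*i+1) = l i)).image cell).card
      ≤ 1 + K1 + (S2 j c).card + (S3 c).card := by
    intro c
    let κ : ℕ → Option (ℕ × ℕ) := fun k =>
      if on c k then some (b (lev c k), cnt (b (lev c k)) k / s) else none
    calc _ ≤ ((range (2*n+1)).image κ).card := by
          apply card_le_card_of_injOn some
          · intro z hz
            simp only [coe_image, Set.mem_image, coe_filter, Set.mem_ofPred_eq, mem_range] at hz ⊢
            obtain ⟨i, ⟨hi, ho, hl⟩, rfl⟩ := hz
            refine ⟨2*i+1, by simp; omega, ?_⟩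
            simp only [κ, if_pos ho, hl, cell]
          · exact (Option.some_injective _).injOn
      _ ≤ 1 + ((range (2*n)).filter (fun k => κ k ≠ κ (k+1))).card := image_card_changes κ _
      _ ≤ 1 + (S1 c ∪ (S2 j c ∪ S3 c)).card := by
          gcongr
          intro k
          simp only [mem_filter, mem_union, S1, S2, S3]
          rintro ⟨hk, hne⟩
          by_contra hcon
          apply hne
          simp only [hk, true_and] at hcon
          push Not at hcon
          obtain ⟨h1, h2, h3⟩ := hcon
          simp only [κ]
          by_cases hon : on c k
          · have hon' := h1.1 hon
            have e2 := h2 hon hon'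
            have e3 := h3 hon'
            have e2' : b (lev c k) = b (lev c (k+1)) := e2
            rw [if_pos hon, if_pos hon', e2', e3]
          · rw [if_neg hon, if_neg (fun h => hon (h1.2 h))]
      _ ≤ _ := by
          have a1 := card_union_le (S1 c) (S2 j c ∪ S3 c)
          have a2 := card_union_le (S2 j c) (S3 c)
          have a3 := H1 c
          have a4 : (S1 c).card ≤ K1 := a3
          omega
  have h3 : ∑ c, (S3 c).card ≤ (n / s) * w := by
    let B := (range n).image (fun i => b (l i))
    have step : ∀ β k, cnt β k / s ≠ cnt β (k+1) / s → Even (k+1) ∧ β ∈ B := by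
      intro β k hne
      by_contra hcon
      apply hne
      congr 1
      simp only [cnt]
      congr 1
      apply filter_congr
      intro i hi
      constructor
      · rintro ⟨h1, h2⟩; exact ⟨by omega, h2⟩
      · rintro ⟨h1, h2⟩
        refine ⟨?_, h2⟩
        by_contra h3
        have : k = 2*i+1 := by omega
        apply hcon
        exact ⟨⟨i+1, by omega⟩, by rw [← h2]; exact mem_image_of_mem (fun i => b (l i)) hi⟩
    calc ∑ c, (S3 c).card
        ≤ ∑ c, ∑ β ∈ B, ∑ k ∈ (range (2*n)).filter (fun k => cnt β k / s ≠ cnt β (k+1) / s),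
            (if on c (k+1) ∧ b (lev c (k+1)) = β then 1 else 0) := by
          apply sum_le_sum
          intro c _
          rw [sum_comm' (t' := range (2*n)) (s' := fun k => B.filter (fun β => cnt β k / s ≠ cnt β (k+1) / s))]
          · simp only [S3, card_filter]
            apply sum_le_sum
            intro k hk
            split_ifs with h
            · refine le_trans ?_ (single_le_sum (f := fun β => if on c (k+1) ∧ b (lev c (k+1)) = β then 1 else 0)
                (fun _ _ => Nat.zero_le _) (mem_filter.2 ⟨(step _ _ h.2).2, h.2⟩))
              simp [h.1]
            · exact Nat.zero_le _
          · intro x y; simp; tauto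
      _ = ∑ β ∈ B, ∑ k ∈ (range (2*n)).filter (fun k => cnt β k / s ≠ cnt β (k+1) / s),
            (univ.filter (fun c => on c (k+1) ∧ b (lev c (k+1)) = β)).card := by
          rw [sum_comm]
          apply sum_congr rfl
          intro β _
          rw [sum_comm]
          apply sum_congr rfl
          intro k _
          rw [card_filter]
      _ ≤ ∑ β ∈ B, ∑ k ∈ (range (2*n)).filter (fun k => cnt β k / s ≠ cnt β (k+1) / s), w := by
          apply sum_le_sum; intro β _
          apply sum_le_sum; intro k hk
          have hev := (step β k (mem_filter.1 hk).2).1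
          calc _ ≤ (Finset.Ico (β*w) (β*w+w)).card := by
                apply card_le_card_of_injOn (fun c => lev c (k+1) + j)
                · intro c hc
                  simp only [coe_filter, mem_univ, true_and, Set.mem_ofPred_eq, b] at hc
                  have hq := hc.2
                  rw [Nat.div_eq_iff hw] at hq
                  simp only [coe_Ico, Set.mem_Ico]
                  constructor
                  · nlinarith [hq.1]
                  · have := hq.2; omega
                · intro c hc c' hc' he
                  simp only [coe_filter, mem_univ, true_and, Set.mem_ofPred_eq] at hc hc'
                  simp only [add_left_inj] at he
                  exact H3 _ _ _ hev hc.1 hc'.1 he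
            _ = w := by simp
      _ ≤ ∑ β ∈ B, (cnt β (2*n) / s) * w := by
          apply sum_le_sum; intro β _
          rw [sum_const, smul_eq_mul]
          gcongr
          exact mono_changes (fun k => cnt β k / s) (fun a a' h => Nat.div_le_div_right (cnt_mono β h)) _
      _ = (∑ β ∈ B, (cnt β (2*n) / s)) * w := by rw [sum_mul]
      _ ≤ (n / s) * w := by
          gcongr
          rw [Nat.le_div_iff_mul_le hs, sum_mul]
          calc _ ≤ ∑ β ∈ B, cnt β (2*n) := sum_le_sum (fun β _ => Nat.div_mul_le_self _ _)
            _ ≤ ∑ β ∈ B, ((range n).filter (fun i => b (l i) = β)).card := by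
                apply sum_le_sum; intro β _
                apply card_le_card
                intro i; simp only [mem_filter]; tauto
            _ = (range n).card := (card_eq_sum_card_image _ _).symm
            _ = n := card_range n
  calc _ ≤ w * ∑ c, (1 + K1 + (S2 j c).card + (S3 c).card) := by
        gcongr with c; exact hc c
    _ = w * (M * (1 + K1) + ∑ c, (S3 c).card) + w * ∑ c, (S2 j c).card := by
        simp only [sum_add_distrib, sum_const, card_univ, M, smul_eq_mul]; ring
    _ ≤ _ := by gcongr

theorem quad_roots (A B C : ℝ) (hA : A ≠ 0) :
    ∃ Z : Finset ℝ, Z.card ≤ 2 ∧ ∀ x, A * x^2 + B * x + C = 0 → x ∈ Z := by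
  by_cases h : ∃ x0, A * x0^2 + B * x0 + C = 0
  · obtain ⟨x0, h0⟩ := h
    refine ⟨{x0, -B/A - x0}, card_le_two, ?_⟩
    intro x hx
    have : (x - x0) * (A * (x + x0) + B) = 0 := by linear_combination hx - h0
    rcases mul_eq_zero.1 this with h | h
    · simp; left; linarith
    · simp; right; field_simp; linarith
  · exact ⟨∅, by simp, fun x hx => absurd ⟨x, hx⟩ h⟩

theorem two_circles (a b q a' b' q' : ℝ) (h : ¬ (a = a' ∧ b = b' ∧ q = q')) :
    ∃ Z : Finset ℝ, Z.card ≤ 2 ∧ ∀ x y, (x - a)^2 + (y - b)^2 = q → (x - a')^2 + (y - b')^2 = q' → x ∈ Z := by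
  by_cases hb : b = b'
  · by_cases ha : a = a'
    · refine ⟨∅, by simp, ?_⟩
      intro x y h1 h2
      exfalso; apply h; subst hb; subst ha
      exact ⟨rfl, rfl, by linarith⟩
    · have ha' : a - a' ≠ 0 := sub_ne_zero.2 ha
      refine ⟨{(q' - q - a'^2 + a^2) / (2*(a - a'))}, by simp, ?_⟩
      intro x y h1 h2
      subst hb
      simp only [mem_singleton]
      field_simp
      linear_combination h2 - h1
  · have hb' : b - b' ≠ 0 := sub_ne_zero.2 hb
    obtain ⟨Z, hZ, hz⟩ := quad_roots (4*(b-b')^2 + 4*(a-a')^2)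
      (-8*(b-b')^2*a - 4*(a-a')*((q' - q - a'^2 + a^2 - b'^2 + b^2) - 2*(b-b')*b))
      (4*(b-b')^2*(a^2 - q) + ((q' - q - a'^2 + a^2 - b'^2 + b^2) - 2*(b-b')*b)^2) (by positivity)
    refine ⟨Z, hZ, fun x y h1 h2 => hz x ?_⟩
    have e : 2*(b-b')*y = (q' - q - a'^2 + a^2 - b'^2 + b^2) - 2*(a-a')*x := by
      linear_combination h2 - h1
    have e2 : 2*(b-b')*(y-b) = (q' - q - a'^2 + a^2 - b'^2 + b^2) - 2*(b-b')*b - 2*(a-a')*x := by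
      linear_combination e
    have e3 : (2*(b-b')*(y-b))^2 = ((q' - q - a'^2 + a^2 - b'^2 + b^2) - 2*(b-b')*b - 2*(a-a')*x)^2 := by
      rw [e2]
    linear_combination 4*(b-b')^2 * h1 - e3

theorem z_count (θ : ℕ → ℝ) (hθ : StrictMono θ) (Z : Finset ℝ) (S : Finset ℕ)
    (hS : ∀ k ∈ S, ∃ ξ ∈ Z, θ k ≤ ξ ∧ ξ ≤ θ (k+1)) : S.card ≤ 2 * Z.card := by
  classical
  have h1 : S ⊆ Z.biUnion (fun ξ => S.filter (fun k => θ k ≤ ξ ∧ ξ ≤ θ (k+1))) := by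
    intro k hk
    obtain ⟨ξ, hξ, h⟩ := hS k hk
    simp only [mem_biUnion, mem_filter]
    exact ⟨ξ, hξ, hk, h⟩
  refine (card_le_card h1).trans (card_biUnion_le.trans ?_)
  rw [mul_comm, ← smul_eq_mul]
  apply sum_le_card_nsmul
  intro ξ _
  set T := S.filter (fun k => θ k ≤ ξ ∧ ξ ≤ θ (k+1)) with hT
  rcases T.eq_empty_or_nonempty with h | h
  · simp [h]
  · have hsub : T ⊆ {T.min' h, T.min' h + 1} := by
      intro k hk
      have hm := min'_le T k hk
      have hmT := min'_mem T h
      simp only [hT, mem_filter] at hk hmT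
      simp only [mem_insert, mem_singleton]
      by_contra hcon
      push Not at hcon
      have : T.min' h + 1 < k := by omega
      have := hθ this
      linarith [hk.2.1, hmT.2.2]
    exact (card_le_card hsub).trans card_le_two

/-- value of the upper / lower arc -/
def arcVal (a b q : ℝ) (s : Bool) (x : ℝ) : ℝ := b + (if s then 1 else -1) * Real.sqrt (q - (x-a)^2)

theorem arcVal_cont (a b q : ℝ) (s : Bool) : Continuous (arcVal a b q s) := by
  unfold arcVal; fun_prop

theorem arcVal_circle (a b q : ℝ) (s : Bool) (x : ℝ) (h : (x-a)^2 ≤ q) :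
    (x-a)^2 + (arcVal a b q s x - b)^2 = q := by
  have := Real.sq_sqrt (show 0 ≤ q - (x-a)^2 by linarith)
  unfold arcVal
  cases s <;> simp [this]

theorem arcVal_exists (a b q x y : ℝ) (h : (x-a)^2 + (y-b)^2 = q) :
    (x-a)^2 ≤ q ∧ ∃ s, arcVal a b q s x = y := by
  refine ⟨by nlinarith [sq_nonneg (y-b)], ?_⟩
  have e : q - (x-a)^2 = (y-b)^2 := by linarith
  unfold arcVal
  rw [e, Real.sqrt_sq_eq_abs]
  rcases le_total 0 (y-b) with h0 | h0
  · exact ⟨true, by rw [abs_of_nonneg h0]; simp⟩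
  · exact ⟨false, by rw [abs_of_nonpos h0]; simp⟩

theorem arcs_meet {ι : Type*} (a b q : ι → ℝ)
    (hinj : ∀ d d', a d = a d' → b d = b d' → q d = q d' → d = d') (c c' : ι × Bool) (hne : c ≠ c') :
    ∃ Z : Finset ℝ, Z.card ≤ 2 ∧ ∀ x, (x - a c.1)^2 ≤ q c.1 → (x - a c'.1)^2 ≤ q c'.1 →
      arcVal (a c.1) (b c.1) (q c.1) c.2 x = arcVal (a c'.1) (b c'.1) (q c'.1) c'.2 x → x ∈ Z := by
  obtain ⟨d, s⟩ := c
  obtain ⟨d', s'⟩ := c'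
  by_cases hd : d = d'
  · subst hd
    obtain ⟨Z, hZ, hz⟩ := quad_roots 1 (-2 * a d) ((a d)^2 - q d) one_ne_zero
    refine ⟨Z, hZ, fun x h1 h2 h3 => hz x ?_⟩
    have hs : s ≠ s' := fun h => hne (by rw [h])
    simp only at h1 h3
    have h0 : Real.sqrt (q d - (x - a d)^2) = 0 := by
      unfold arcVal at h3
      cases s <;> cases s' <;> simp at h3 hs ⊢ <;> linarith
    rw [Real.sqrt_eq_zero (by linarith)] at h0
    linarith
  · obtain ⟨Z, hZ, hz⟩ := two_circles (a d) (b d) (q d) (a d') (b d') (q d')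
      (fun h => hd (hinj d d' h.1 h.2.1 h.2.2))
    refine ⟨Z, hZ, fun x h1 h2 h3 => hz x _ (arcVal_circle _ _ _ s x h1) ?_⟩
    simp only at h3
    rw [h3]
    exact arcVal_circle _ _ _ s' x h2

theorem exists_grid (X : ℕ → ℝ) (hX : StrictMono X) (Bad : Set ℝ) (hB : Bad.Finite) :
    ∃ θ : ℕ → ℝ, StrictMono θ ∧ (∀ i, θ (2*i+1) = X i) ∧ ∀ k, Even k → θ k ∉ Bad := by
  have key : ∀ u v : ℝ, u < v → ∃ g, u < g ∧ g < v ∧ g ∉ Bad := by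
    intro u v h
    obtain ⟨g, hg⟩ := ((Set.Ioo_infinite h).sdiff hB).nonempty
    exact ⟨g, hg.1.1, hg.1.2, hg.2⟩
  have key2 : ∀ i : ℕ, ∃ g, (0 < i → X (i-1) < g) ∧ g < X i ∧ g ∉ Bad := by
    intro i
    rcases Nat.eq_zero_or_pos i with h | h
    · obtain ⟨g, _, h2, h3⟩ := key (X i - 1) (X i) (by linarith)
      exact ⟨g, by omega, h2, h3⟩
    · obtain ⟨g, h1, h2, h3⟩ := key (X (i-1)) (X i) (hX (by omega))
      exact ⟨g, fun _ => h1, h2, h3⟩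
  choose g hg1 hg2 hg3 using key2
  refine ⟨fun k => if Even k then g (k/2) else X (k/2), ?_, ?_, ?_⟩
  · apply strictMono_nat_of_lt_succ
    intro k
    rcases Nat.even_or_odd k with ⟨m, hm⟩ | ⟨m, hm⟩
    · have e1 : Even k := ⟨m, hm⟩
      have e2 : ¬ Even (k+1) := by rw [Nat.even_add_one]; simpa using e1
      have e3 : (k+1)/2 = k/2 := by omega
      simp only [if_pos e1, if_neg e2, e3]
      exact hg2 _
    · have e1 : ¬ Even k := by rw [Nat.not_even_iff_odd]; exact ⟨m, hm⟩
      have e2 : Even (k+1) := by rw [Nat.even_add_one]; exact e1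
      have e3 : k/2 = (k+1)/2 - 1 := by omega
      simp only [if_neg e1, if_pos e2]
      rw [e3]
      exact hg1 _ (by omega)
  · intro i
    have e1 : ¬ Even (2*i+1) := by rw [Nat.not_even_iff_odd]; exact ⟨i, rfl⟩
    simp only [if_neg e1]
    congr 1; omega
  · intro k hk
    simp only [if_pos hk]
    exact hg3 _

open Classical in
theorem planar_cut {ι : Type*} [Fintype ι] (n : ℕ) (X Y : ℕ → ℝ) (hX : StrictMono X)
    (a b q : ι → ℝ) (hinj : ∀ d d', a d = a d' → b d = b d' → q d = q d' → d = d')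
    (r : ℕ) (hr : 1 ≤ r) (hrN : r ≤ Fintype.card ι) :
    ∃ cell : ℕ → ℕ × ℕ, (∀ key, ((range n).filter (fun i => cell i = key)).card ≤ n / r^2 + 1) ∧
      ∑ d, (((range n).filter (fun i => (X i - a d)^2 + (Y i - b d)^2 = q d)).image cell).card
        ≤ 44 * Fintype.card ι * r := by
  choose! Z hZ hz using arcs_meet a b q hinj
  let Bad : Set ℝ := ⋃ c : ι × Bool, ⋃ c' : ι × Bool, (Z c c' : Set ℝ)
  have hBad : Bad.Finite := Set.finite_iUnion (fun c => Set.finite_iUnion (fun c' => finite_toSet _))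
  obtain ⟨θ, hθ, hθX, hθB⟩ := exists_grid X hX Bad hBad
  let on' : ι × Bool → ℝ → Prop := fun c x => (x - a c.1)^2 ≤ q c.1
  let hv : ι × Bool → ℝ → ℝ := fun c x => arcVal (a c.1) (b c.1) (q c.1) c.2 x
  have hvc : ∀ c, Continuous (hv c) := fun c => arcVal_cont _ _ _ _
  let on : ι × Bool → ℕ → Prop := fun c k => on' c (θ k)
  let lt : ι × Bool → ι × Bool → ℕ → Prop := fun c' c k => on' c' (θ k) ∧ hv c' (θ k) < hv c (θ k)
  let lev : ι × Bool → ℕ → ℕ := fun c k => (univ.filter (fun c' => lt c' c k)).card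
  let l : ℕ → ℕ := fun i => (univ.filter (fun c' => on' c' (X i) ∧ hv c' (X i) < Y i)).card
  have conv : ∀ c k x, on c k → on c (k+1) → θ k ≤ x → x ≤ θ (k+1) → on' c x := by
    intro c k x h1 h2 h3 h4
    simp only [on, on'] at h1 h2 ⊢
    rcases le_total (a c.1) x with h | h <;> nlinarith
  have onch : ∀ c, ∃ W : Finset ℝ, W.card ≤ 2 ∧ ∀ k, ¬ (on c k ↔ on c (k+1)) →
      ∃ ξ ∈ W, θ k ≤ ξ ∧ ξ ≤ θ (k+1) := by
    intro c
    obtain ⟨W, hW, hw⟩ := quad_roots 1 (-2 * a c.1) ((a c.1)^2 - q c.1) one_ne_zero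
    refine ⟨W, hW, fun k hk => ?_⟩
    have hle : θ k ≤ θ (k+1) := (hθ (Nat.lt_succ_self k)).le
    have hcont : ContinuousOn (fun x => (x - a c.1)^2 - q c.1) (Set.Icc (θ k) (θ (k+1))) := by
      fun_prop
    have : (0:ℝ) ∈ (fun x => (x - a c.1)^2 - q c.1) '' Set.Icc (θ k) (θ (k+1)) := by
      simp only [on, on'] at hk
      by_cases h1 : (θ k - a c.1)^2 ≤ q c.1
      · have h2 : ¬ (θ (k+1) - a c.1)^2 ≤ q c.1 := by tauto
        exact intermediate_value_Icc hle hcont ⟨by linarith, by linarith⟩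
      · have h2 : (θ (k+1) - a c.1)^2 ≤ q c.1 := by tauto
        exact intermediate_value_Icc' hle hcont ⟨by linarith, by linarith⟩
    obtain ⟨ξ, hξ, h0⟩ := this
    refine ⟨ξ, hw ξ ?_, hξ.1, hξ.2⟩
    simp only at h0
    linarith
  have H1 : ∀ c, ((range (2*n)).filter (fun k => ¬ (on c k ↔ on c (k+1)))).card ≤ 4 := by
    intro c
    obtain ⟨W, hW, hw⟩ := onch c
    have := z_count θ hθ W ((range (2*n)).filter (fun k => ¬ (on c k ↔ on c (k+1))))
      (fun k hk => hw k (mem_filter.1 hk).2)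
    omega
  have H2 : ∀ c c', ((range (2*n)).filter (fun k => on c k ∧ on c (k+1) ∧
      ¬ (lt c' c k ↔ lt c' c (k+1)))).card ≤ 8 := by
    intro c c'
    by_cases hcc : c = c'
    · subst hcc
      rw [filter_false_of_mem]
      · simp
      · intro k _; simp [lt]
    obtain ⟨W, hW, hw⟩ := onch c'
    have := z_count θ hθ (W ∪ Z c c') ((range (2*n)).filter (fun k => on c k ∧ on c (k+1) ∧
      ¬ (lt c' c k ↔ lt c' c (k+1)))) (by
        intro k hk
        obtain ⟨_, h1, h2, h3⟩ := mem_filter.1 hk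
        by_cases h4 : on c' k ↔ on c' (k+1)
        · have h5 : on c' k ∧ on c' (k+1) := by
            by_contra hcon
            apply h3
            have h6 : ¬ on c' k := by tauto
            have h7 : ¬ on c' (k+1) := by tauto
            simp only [lt]
            constructor
            · intro h; exact absurd h.1 h6
            · intro h; exact absurd h.1 h7
          have hle : θ k ≤ θ (k+1) := (hθ (Nat.lt_succ_self k)).le
          have hcont : ContinuousOn (fun x => hv c' x - hv c x) (Set.Icc (θ k) (θ (k+1))) :=
            ((hvc c').sub (hvc c)).continuousOn
          have : (0:ℝ) ∈ (fun x => hv c' x - hv c x) '' Set.Icc (θ k) (θ (k+1)) := by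
            by_cases h6 : hv c' (θ k) < hv c (θ k)
            · have h7 : ¬ hv c' (θ (k+1)) < hv c (θ (k+1)) := by
                intro h7; apply h3; exact ⟨fun _ => ⟨h5.2, h7⟩, fun _ => ⟨h5.1, h6⟩⟩
              exact intermediate_value_Icc hle hcont ⟨by linarith, by linarith⟩
            · have h7 : hv c' (θ (k+1)) < hv c (θ (k+1)) := by
                by_contra h7; apply h3
                exact ⟨fun h => absurd h.2 h6, fun h => absurd h.2 h7⟩
              exact intermediate_value_Icc' hle hcont ⟨by linarith, by linarith⟩
          obtain ⟨ξ, hξ, h0⟩ := this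
          refine ⟨ξ, mem_union_right _ (hz c c' hcc ξ (conv c k ξ h1 h2 hξ.1 hξ.2)
            (conv c' k ξ h5.1 h5.2 hξ.1 hξ.2) ?_), hξ.1, hξ.2⟩
          simp only at h0
          exact (sub_eq_zero.1 h0).symm
        · obtain ⟨ξ, hξ, h⟩ := hw k h4
          exact ⟨ξ, mem_union_left _ hξ, h⟩)
    have h2 := card_union_le W (Z c c')
    have h3 := hZ c c' hcc
    omega
  have levlt : ∀ k c c', on c k → hv c (θ k) < hv c' (θ k) → lev c k < lev c' k := by
    intro k c c' h1 h2
    apply card_lt_card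
    rw [ssubset_iff_of_subset]
    · refine ⟨c, ?_, ?_⟩
      · simp only [mem_filter, mem_univ, true_and, lt]; exact ⟨h1, h2⟩
      · simp [lt]
    · intro x; simp only [mem_filter, mem_univ, true_and, lt]
      rintro ⟨h3, h4⟩; exact ⟨h3, h4.trans h2⟩
  have H3 : ∀ k c c', Even k → on c k → on c' k → lev c k = lev c' k → c = c' := by
    intro k c c' hk h1 h2 h3
    by_contra hne
    rcases lt_trichotomy (hv c (θ k)) (hv c' (θ k)) with h | h | h
    · exact (levlt k c c' h1 h).ne h3
    · apply hθB k hk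
      exact Set.mem_iUnion.2 ⟨c, Set.mem_iUnion.2 ⟨c', hz c c' hne _ h1 h2 h⟩⟩
    · exact (levlt k c' c h2 h).ne' h3
  set N := Fintype.card ι with hN
  have hw0 : 0 < 2*N / r := Nat.div_pos (by omega) hr
  obtain ⟨cell, hc1, hc2⟩ := cutting n 4 8 (2*N/r) (n/r^2+1) hw0 (Nat.succ_pos _) on lt lev
    (fun _ _ => by simp only [lev]; congr) l (fun c => by convert H1 c)
    (fun c c' => by convert H2 c c') H3
  refine ⟨cell, hc1, ?_⟩
  have hM : Fintype.card (ι × Bool) = 2*N := by simp [hN, mul_comm]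
  rw [hM] at hc2
  set w := 2*N/r with hwdef
  have hle : ∑ d, (((range n).filter (fun i => (X i - a d)^2 + (Y i - b d)^2 = q d)).image cell).card
      ≤ ∑ c, (((range n).filter (fun i => on c (2*i+1) ∧ lev c (2*i+1) = l i)).image cell).card := by
    rw [Fintype.sum_prod_type]
    apply sum_le_sum
    intro d _
    rw [Fintype.sum_bool]
    refine le_trans (card_le_card ?_) (card_union_le _ _)
    intro z hz
    simp only [mem_image, mem_filter, mem_range] at hz
    obtain ⟨i, ⟨hi, hcirc⟩, rfl⟩ := hz
    obtain ⟨h1, s, h2⟩ := arcVal_exists _ _ _ _ _ hcirc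
    have hmem : cell i ∈ ((range n).filter (fun i => on (d,s) (2*i+1) ∧ lev (d,s) (2*i+1) = l i)).image cell := by
      apply mem_image_of_mem
      simp only [mem_filter, mem_range]
      refine ⟨hi, ?_, ?_⟩
      · simp only [on, on', hθX]; exact h1
      · simp only [lev, lt, l, hθX]
        have : hv (d,s) (X i) = Y i := h2
        rw [this]
    cases s
    · exact mem_union_right _ hmem
    · exact mem_union_left _ hmem
  refine hle.trans ?_
  set S := ∑ c, (((range n).filter (fun i => on c (2*i+1) ∧ lev c (2*i+1) = l i)).image cell).card
  have e1 : w * r ≤ 2*N := Nat.div_mul_le_self _ _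
  have e2 : 2*N < w * r + r := by
    have := Nat.lt_div_mul_add (a := 2*N) (b := r) hr; rw [hwdef]; omega
  have e3 : 2*N ≤ 2 * (w * r) := by nlinarith
  have e4 : n / (n/r^2+1) ≤ r^2 := by
    have : n < (n/r^2+1) * r^2 := by
      have := Nat.lt_div_mul_add (a := n) (b := r^2) (by positivity); nlinarith
    exact Nat.div_le_of_le_mul this.le
  have e5 : n / (n/r^2+1) * w ≤ r * (2*N) := by
    calc _ ≤ r^2 * w := by gcongr
      _ = r * (w * r) := by ring
      _ ≤ _ := by gcongr
  have e6 : 8 * (2*N)^2 ≤ w * (32 * N * r) := by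
    calc 8 * (2*N)^2 = 16 * N * (2 * N) := by ring
      _ ≤ 16 * N * (2 * (w * r)) := by gcongr
      _ = _ := by ring
  have e7 : w * S ≤ w * (44 * N * r) := by
    calc w * S ≤ w * (2*N*(1+4) + n / (n/r^2+1) * w) + 8 * (2*N)^2 := by convert hc2
      _ ≤ w * (2*N*(1+4) + r * (2*N)) + w * (32 * N * r) := by gcongr
      _ = w * (10 * N + 34 * N * r) := by ring
      _ ≤ w * (44 * N * r) := by gcongr; nlinarith
  exact Nat.le_of_mul_le_mul_left e7 hw0

theorem quad_finite (A B C : ℝ) (h : ¬ (A = 0 ∧ B = 0 ∧ C = 0)) :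
    {x : ℝ | A * x^2 + B * x + C = 0}.Finite := by
  by_cases hA : A = 0
  · by_cases hB : B = 0
    · have : {x : ℝ | A * x^2 + B * x + C = 0} = ∅ := by
        ext x
        simp only [Set.mem_ofPred_eq, Set.mem_empty_iff_false, iff_false]
        subst hA; subst hB
        intro h2; apply h; refine ⟨rfl, rfl, by linarith⟩
      rw [this]; exact Set.finite_empty
    · refine (Set.finite_singleton (-C/B)).subset ?_
      intro x hx
      simp only [Set.mem_ofPred_eq] at hx
      subst hA
      simp only [Set.mem_singleton_iff]
      field_simp
      linarith
  · obtain ⟨Z, _, hz⟩ := quad_roots A B C hA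
    exact Z.finite_toSet.subset (fun x hx => hz x hx)

theorem exists_frame (A D : Finset (Fin 3 → ℝ))
    (hD : ∀ d ∈ D, d ≠ 0) :
    ∃ s c : ℝ, s^2 + c^2 = 1 ∧ (∀ p ∈ A, s * p 0 + c * p 2 ≠ 1) ∧
      ∀ d ∈ D, 2 * (s * d 0 + c * d 2) ≠ d 0 ^ 2 + d 1 ^ 2 + d 2 ^ 2 := by
  have fin : ∀ (w0 w2 κ : ℝ), κ ≠ 0 → {t : ℝ | -(w2+κ) * t^2 + (2*w0) * t + (w2-κ) = 0}.Finite := by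
    intro w0 w2 κ hκ
    apply quad_finite
    rintro ⟨h1, _, h3⟩
    apply hκ; linarith
  have hpos : ∀ d ∈ D, (d 0 ^ 2 + d 1 ^ 2 + d 2 ^ 2)/2 ≠ 0 := by
    intro d hd h
    apply hD d hd
    have h0 : d 0 = 0 := by nlinarith [sq_nonneg (d 0), sq_nonneg (d 1), sq_nonneg (d 2)]
    have h1 : d 1 = 0 := by nlinarith [sq_nonneg (d 0), sq_nonneg (d 1), sq_nonneg (d 2)]
    have h2 : d 2 = 0 := by nlinarith [sq_nonneg (d 0), sq_nonneg (d 1), sq_nonneg (d 2)]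
    ext i; fin_cases i <;> simp [h0, h1, h2]
  have hf1 : (⋃ p ∈ A, {t : ℝ | -(p 2+1) * t^2 + (2*p 0) * t + (p 2-1) = 0}).Finite :=
    Set.Finite.biUnion A.finite_toSet (fun p _ => fin _ _ _ one_ne_zero)
  have hf2 : (⋃ d ∈ D, {t : ℝ | -(d 2+(d 0 ^ 2 + d 1 ^ 2 + d 2 ^ 2)/2) * t^2 + (2*d 0) * t
      + (d 2-(d 0 ^ 2 + d 1 ^ 2 + d 2 ^ 2)/2) = 0}).Finite :=
    Set.Finite.biUnion D.finite_toSet (fun d hd => fin _ _ _ (hpos d hd))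
  obtain ⟨t, ht⟩ := (hf1.union hf2).infinite_compl.nonempty
  simp only [Set.compl_union, Set.mem_inter_iff, Set.mem_compl_iff, Set.mem_iUnion, not_exists,
    Set.mem_ofPred_eq] at ht
  have hp : 1 + t^2 ≠ 0 := by positivity
  refine ⟨2*t/(1+t^2), (1-t^2)/(1+t^2), by field_simp; ring, ?_, ?_⟩
  · intro p hp' h
    apply ht.1 p hp'
    field_simp at h
    linarith
  · intro d hd h
    apply ht.2 d hd
    field_simp at h
    linarith

theorem exists_rot {V : Type*} (A : Finset V) (x y : V → ℝ)
    (h : ∀ p ∈ A, ∀ p' ∈ A, x p = x p' → y p = y p' → p = p') :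
    ∃ s c : ℝ, s^2 + c^2 = 1 ∧ Set.InjOn (fun p => c * x p + s * y p) A := by
  classical
  have hf : (⋃ z ∈ (A ×ˢ A).filter (fun z => z.1 ≠ z.2),
      {t : ℝ | -(x z.1 - x z.2) * t^2 + (2*(y z.1 - y z.2)) * t + (x z.1 - x z.2) = 0}).Finite := by
    apply Set.Finite.biUnion (finite_toSet _)
    intro z hz
    simp only [coe_filter, mem_product, Set.mem_ofPred_eq] at hz
    apply quad_finite
    rintro ⟨_, h2, h3⟩
    exact hz.2 (h _ hz.1.1 _ hz.1.2 (by linarith) (by linarith))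
  obtain ⟨t, ht⟩ := hf.infinite_compl.nonempty
  simp only [Set.mem_compl_iff, Set.mem_iUnion, not_exists, Set.mem_ofPred_eq] at ht
  have hp : 1 + t^2 ≠ 0 := by positivity
  refine ⟨2*t/(1+t^2), (1-t^2)/(1+t^2), by field_simp; ring, ?_⟩
  intro p hpA p' hpA' he
  by_contra hne
  apply ht (p, p') (by simp only [mem_filter, mem_product]; exact ⟨⟨hpA, hpA'⟩, hne⟩)
  simp only at he ⊢
  field_simp at he
  linarith

theorem sphere_planar (A D : Finset (Fin 3 → ℝ))
    (hA : ∀ p ∈ A, p 0 ^ 2 + p 1 ^ 2 + p 2 ^ 2 = 1) (hD : ∀ d ∈ D, d ≠ 0) :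
    ∃ X Y a b q : (Fin 3 → ℝ) → ℝ, Set.InjOn X A ∧
      (∀ d ∈ D, ∀ p ∈ A, 2 * (p 0 * d 0 + p 1 * d 1 + p 2 * d 2) = d 0 ^ 2 + d 1 ^ 2 + d 2 ^ 2 →
        (X p - a d)^2 + (Y p - b d)^2 = q d) ∧
      (∀ d ∈ D, ∀ d' ∈ D, a d = a d' → b d = b d' → q d = q d' → d = d') := by
  obtain ⟨s, c, hsc, hpA, hdD⟩ := exists_frame A D hD
  let pn : (Fin 3 → ℝ) → ℝ := fun p => s * p 0 + c * p 2
  let pu : (Fin 3 → ℝ) → ℝ := fun p => c * p 0 - s * p 2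
  let pv : (Fin 3 → ℝ) → ℝ := fun p => p 1
  have hrec : ∀ p p', pn p = pn p' → pu p = pu p' → pv p = pv p' → p = p' := by
    intro p p' h1 h2 h3
    simp only [pn, pu, pv] at h1 h2 h3
    have e0 : p 0 = p' 0 := by linear_combination s * h1 + c * h2 - (p 0 - p' 0) * hsc
    have e2 : p 2 = p' 2 := by linear_combination c * h1 - s * h2 - (p 2 - p' 2) * hsc
    ext i; fin_cases i
    · exact e0
    · exact h3
    · exact e2
  have hnorm : ∀ p, pn p ^ 2 + pu p ^ 2 + pv p ^ 2 = p 0 ^ 2 + p 1 ^ 2 + p 2 ^ 2 := by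
    intro p; simp only [pn, pu, pv]; linear_combination (p 0 ^ 2 + p 2 ^ 2) * hsc
  have hdot : ∀ p d, pn p * pn d + pu p * pu d + pv p * pv d = p 0 * d 0 + p 1 * d 1 + p 2 * d 2 := by
    intro p d; simp only [pn, pu, pv]; linear_combination (p 0 * d 0 + p 2 * d 2) * hsc
  let x : (Fin 3 → ℝ) → ℝ := fun p => pu p / (1 - pn p)
  let y : (Fin 3 → ℝ) → ℝ := fun p => pv p / (1 - pn p)
  have h1n : ∀ p ∈ A, 1 - pn p ≠ 0 := fun p hp h => hpA p hp (by simp only [pn] at h; linarith)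
  have hxy : ∀ p ∈ A, (x p ^ 2 + y p ^ 2) * (1 - pn p) = 1 + pn p := by
    intro p hp
    have h1 := h1n p hp
    have h2 := (hnorm p).trans (hA p hp)
    simp only [x, y]
    field_simp
    linear_combination h2
  have hinj : ∀ p ∈ A, ∀ p' ∈ A, x p = x p' → y p = y p' → p = p' := by
    intro p hp p' hp' hx hy
    have e1 := hxy p hp
    have e2 := hxy p' hp'
    rw [← hx, ← hy] at e2
    have hS : x p ^ 2 + y p ^ 2 + 1 ≠ 0 := by positivity
    have en : pn p = pn p' := by
      have : (x p ^ 2 + y p ^ 2 + 1) * (pn p - pn p') = 0 := by linear_combination e2 - e1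
      rcases mul_eq_zero.1 this with h | h
      · exact absurd h hS
      · linarith
    apply hrec p p' en
    · simp only [x] at hx
      rw [← en] at hx
      exact (div_left_inj' (h1n p hp)).1 hx
    · simp only [y] at hy
      rw [← en] at hy
      exact (div_left_inj' (h1n p hp)).1 hy
  obtain ⟨S, C, hSC, hX⟩ := exists_rot A x y hinj
  let δ : (Fin 3 → ℝ) → ℝ := fun d => (d 0 ^ 2 + d 1 ^ 2 + d 2 ^ 2) / 2
  let k : (Fin 3 → ℝ) → ℝ := fun d => δ d - pn d
  have hk : ∀ d ∈ D, k d ≠ 0 := by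
    intro d hd h
    apply hdD d hd
    simp only [k, δ, pn] at h; linarith
  let α : (Fin 3 → ℝ) → ℝ := fun d => pu d / k d
  let β : (Fin 3 → ℝ) → ℝ := fun d => pv d / k d
  let e : (Fin 3 → ℝ) → ℝ := fun d => (δ d + pn d) / k d
  refine ⟨fun p => C * x p + S * y p, fun p => -S * x p + C * y p,
    fun d => C * α d + S * β d, fun d => -S * α d + C * β d, fun d => α d ^ 2 + β d ^ 2 - e d, hX, ?_, ?_⟩
  · intro d hd p hp hpd
    have h1 := h1n p hp
    have h2 := hk d hd
    have h3 : pn p * pn d + pu p * pu d + pv p * pv d = δ d := by rw [hdot]; simp only [δ]; linarith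
    have main : (x p ^ 2 + y p ^ 2) - 2 * α d * x p - 2 * β d * y p + e d = 0 := by
      have h4 := hxy p hp
      have h5 : x p * (1 - pn p) = pu p := div_mul_cancel₀ _ h1
      have h6 : y p * (1 - pn p) = pv p := div_mul_cancel₀ _ h1
      have h7 : α d * k d = pu d := div_mul_cancel₀ _ h2
      have h8 : β d * k d = pv d := div_mul_cancel₀ _ h2
      have h9 : e d * k d = δ d + pn d := div_mul_cancel₀ _ h2
      have h10 : k d = δ d - pn d := rfl
      have : ((x p ^ 2 + y p ^ 2) - 2 * α d * x p - 2 * β d * y p + e d) * ((1 - pn p) * k d) = 0 := by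
        have t1 : ((x p ^ 2 + y p ^ 2) - 2 * α d * x p - 2 * β d * y p + e d) * ((1 - pn p) * k d)
          = ((x p ^ 2 + y p ^ 2) * (1 - pn p)) * k d - 2 * (α d * k d) * (x p * (1 - pn p))
            - 2 * (β d * k d) * (y p * (1 - pn p)) + (e d * k d) * (1 - pn p) := by ring
        rw [t1, h4, h5, h6, h7, h8, h9, h10]
        linear_combination -2 * h3
      rcases mul_eq_zero.1 this with h | h
      · exact h
      · exact absurd h (mul_ne_zero h1 h2)
    simp only
    linear_combination main + ((x p - α d)^2 + (y p - β d)^2) * hSC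
  · intro d hd d' hd' h1 h2 h3
    simp only at h1 h2 h3
    have ea : α d = α d' := by linear_combination C * h1 - S * h2 - (α d - α d') * hSC
    have eb : β d = β d' := by linear_combination S * h1 + C * h2 - (β d - β d') * hSC
    have ee : e d = e d' := by rw [ea, eb] at h3; linarith
    have hfac : ∀ d ∈ D, pu d = k d * α d ∧ pv d = k d * β d ∧ pn d = k d * ((e d - 1)/2) ∧
        k d * (α d ^ 2 + β d ^ 2 + ((e d - 1)/2)^2) = e d + 1 ∧ e d + 1 ≠ 0 := by
      intro d hd
      have hk' := hk d hd
      have h7 : pu d = k d * α d := by rw [mul_comm]; exact (div_mul_cancel₀ _ hk').symm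
      have h8 : pv d = k d * β d := by rw [mul_comm]; exact (div_mul_cancel₀ _ hk').symm
      have h9 : e d * k d = δ d + pn d := div_mul_cancel₀ _ hk'
      have h10 : k d = δ d - pn d := rfl
      have h11 : pn d = k d * ((e d - 1)/2) := by linear_combination -h9 / 2 + h10 / 2
      have h12 : δ d = k d * ((e d + 1)/2) := by linear_combination -h9 / 2 - h10 / 2
      have h13 : pn d ^ 2 + pu d ^ 2 + pv d ^ 2 = 2 * δ d := by rw [hnorm]; simp only [δ]; ring
      have hδ : δ d ≠ 0 := by
        intro h0
        have z0 : pn d = 0 := by nlinarith [sq_nonneg (pn d), sq_nonneg (pu d), sq_nonneg (pv d)]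
        apply hk'; rw [h10, h0, z0]; ring
      refine ⟨h7, h8, h11, ?_, ?_⟩
      · apply mul_left_cancel₀ hk'
        rw [h11, h7, h8, h12] at h13
        linear_combination h13
      · intro h0; apply hδ; rw [h12, h0]; ring
    obtain ⟨u1, v1, n1, q1, ne1⟩ := hfac d hd
    obtain ⟨u2, v2, n2, q2, _⟩ := hfac d' hd'
    rw [← ea] at u2; rw [← eb] at v2; rw [← ee] at n2
    rw [← ea, ← eb, ← ee] at q2
    have hQ : (α d ^ 2 + β d ^ 2 + ((e d - 1)/2)^2) ≠ 0 := by
      intro h; rw [h, mul_zero] at q1; exact ne1 q1.symm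
    have hkk : k d = k d' := mul_right_cancel₀ hQ (q1.trans q2.symm)
    rw [← hkk] at u2 v2 n2
    exact hrec d d' (n1.trans n2.symm) (u1.trans u2.symm) (v1.trans v2.symm)

theorem enumerate {V : Type*} (A : Finset V) (X : V → ℝ) (hX : Set.InjOn X A) :
    ∃ X' : ℕ → ℝ, StrictMono X' ∧ ∃ idx : V → ℕ, Set.InjOn idx A ∧
      ∀ p ∈ A, idx p < A.card ∧ X' (idx p) = X p := by
  classical
  set I := A.image X with hI
  have hcard : I.card = A.card := card_image_of_injOn hX
  let f := I.orderIsoOfFin hcard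
  let B := ∑ x ∈ I, |x|
  have hB : ∀ x ∈ I, x ≤ B := fun x hx => (le_abs_self x).trans
    (single_le_sum (f := fun x => |x|) (fun _ _ => abs_nonneg _) hx)
  let X' : ℕ → ℝ := fun i => if h : i < A.card then (f ⟨i, h⟩ : ℝ) else B + i + 1
  have hX'1 : ∀ i (h : i < A.card), X' i = (f ⟨i, h⟩ : ℝ) := fun i h => dif_pos h
  have hX'2 : ∀ i, ¬ i < A.card → X' i = B + i + 1 := fun i h => dif_neg h
  let idx : V → ℕ := fun p => if h : X p ∈ I then ((f.symm ⟨X p, h⟩ : Fin A.card) : ℕ) else 0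
  have hmem : ∀ p ∈ A, X p ∈ I := fun p hp => mem_image_of_mem X hp
  have key : ∀ p ∈ A, idx p < A.card ∧ X' (idx p) = X p := by
    intro p hp
    have h1 : idx p = ((f.symm ⟨X p, hmem p hp⟩ : Fin A.card) : ℕ) := dif_pos (hmem p hp)
    have h2 : idx p < A.card := by rw [h1]; exact Fin.is_lt _
    refine ⟨h2, ?_⟩
    rw [hX'1 _ h2]
    have : (⟨idx p, h2⟩ : Fin A.card) = f.symm ⟨X p, hmem p hp⟩ := Fin.ext h1
    rw [this]; simp
  refine ⟨X', ?_, idx, ?_, key⟩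
  · apply strictMono_nat_of_lt_succ
    intro i
    by_cases h : i + 1 < A.card
    · rw [hX'1 i (by omega), hX'1 (i+1) h]
      have : f ⟨i, by omega⟩ < f ⟨i+1, h⟩ := f.strictMono (by simp [Fin.lt_def])
      exact this
    · rw [hX'2 (i+1) h]
      by_cases h' : i < A.card
      · rw [hX'1 i h']
        have := hB _ (f ⟨i, h'⟩).2
        push_cast
        have : (0:ℝ) ≤ i := Nat.cast_nonneg i
        linarith
      · rw [hX'2 i h']; push_cast; linarith
  · intro p hp p' hp' he
    apply hX hp hp'
    rw [← (key p hp).2, ← (key p' hp').2, he]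

/-- points `x ∈ A` with `x - d ∈ A`. -/
def RR {V : Type*} [AddCommGroup V] [DecidableEq V] (A : Finset V) (d : V) : Finset V :=
  A.filter (fun x => x - d ∈ A)

theorem RR_plane (A : Finset (Fin 3 → ℝ)) (hA : ∀ p ∈ A, p 0 ^ 2 + p 1 ^ 2 + p 2 ^ 2 = 1)
    (d p : Fin 3 → ℝ) (hp : p ∈ RR A d) :
    2 * (p 0 * d 0 + p 1 * d 1 + p 2 * d 2) = d 0 ^ 2 + d 1 ^ 2 + d 2 ^ 2 := by
  simp only [RR, mem_filter] at hp
  have h1 := hA p hp.1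
  have h2 := hA _ hp.2
  simp only [Pi.sub_apply] at h2
  linear_combination h1 - h2

theorem sphere_P1 (A : Finset (Fin 3 → ℝ)) (hA : ∀ p ∈ A, p 0 ^ 2 + p 1 ^ 2 + p 2 ^ 2 = 1)
    (d d' : Fin 3 → ℝ) (hd : d ≠ 0) (hd' : d' ≠ 0) (hne : d ≠ d') : (RR A d ∩ RR A d').card ≤ 2 := by
  obtain ⟨X, Y, a, b, q, h1, h2, h3⟩ := sphere_planar A {d, d'} hA (by
    intro x hx; simp at hx; rcases hx with rfl | rfl <;> assumption)
  obtain ⟨Z, hZ, hz⟩ := two_circles (a d) (b d) (q d) (a d') (b d') (q d') (fun h =>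
    hne (h3 d (by simp) d' (by simp) h.1 h.2.1 h.2.2))
  refine le_trans (card_le_card_of_injOn X ?_ ?_) hZ
  · intro p hp
    simp only [coe_inter, Set.mem_inter_iff, mem_coe] at hp
    have hpA : p ∈ A := (mem_filter.1 hp.1).1
    exact hz _ _ (h2 d (by simp) p hpA (RR_plane A hA d p hp.1))
      (h2 d' (by simp) p hpA (RR_plane A hA d' p hp.2))
  · refine h1.mono ?_
    intro p hp
    simp only [coe_inter, Set.mem_inter_iff, mem_coe] at hp
    exact (mem_filter.1 hp.1).1

theorem sphere_P2 (A : Finset (Fin 3 → ℝ)) (hA : ∀ p ∈ A, p 0 ^ 2 + p 1 ^ 2 + p 2 ^ 2 = 1)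
    (F : Finset (Fin 3 → ℝ)) (hF : ∀ d ∈ F, d ≠ 0) (r : ℕ) (hr : 1 ≤ r) (hrN : r ≤ F.card) :
    ∃ cell : (Fin 3 → ℝ) → ℕ × ℕ,
      (∀ key, (A.filter (fun x => cell x = key)).card ≤ A.card / r^2 + 1) ∧
      ∑ d ∈ F, ((RR A d).image cell).card ≤ 44 * F.card * r := by
  classical
  obtain ⟨X, Y, a, b, q, h1, h2, h3⟩ := sphere_planar A F hA hF
  obtain ⟨X', hX', idx, hidx, hk⟩ := enumerate A X h1
  let pt : ℕ → (Fin 3 → ℝ) := Function.invFunOn idx A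
  have hpt : ∀ p ∈ A, pt (idx p) = p := fun p hp => hidx.leftInvOn_invFunOn hp
  obtain ⟨cell, hc1, hc2⟩ := planar_cut (ι := {d // d ∈ F}) A.card X' (fun i => Y (pt i)) hX'
    (fun d => a d) (fun d => b d) (fun d => q d)
    (fun d d' e1 e2 e3 => Subtype.ext (h3 d d.2 d' d'.2 e1 e2 e3)) r hr (by simpa using hrN)
  refine ⟨fun p => cell (idx p), ?_, ?_⟩
  · intro key
    refine le_trans (card_le_card_of_injOn idx ?_ ?_) (hc1 key)
    · intro p hp
      simp only [coe_filter, Set.mem_ofPred_eq, mem_range] at hp ⊢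
      exact ⟨(hk p hp.1).1, hp.2⟩
    · refine hidx.mono ?_
      intro p hp
      simp only [coe_filter, Set.mem_ofPred_eq] at hp
      exact hp.1
  · rw [← sum_coe_sort F]
    simp only [Fintype.card_coe] at hc2
    refine le_trans (sum_le_sum ?_) hc2
    intro d _
    apply card_le_card
    intro z hz
    obtain ⟨p, hp, rfl⟩ := mem_image.1 hz
    have hpA : p ∈ A := (mem_filter.1 hp).1
    apply mem_image_of_mem
    simp only [mem_filter, mem_range]
    refine ⟨(hk p hpA).1, ?_⟩
    rw [(hk p hpA).2, hpt p hpA]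
    exact h2 d d.2 p hpA (RR_plane A hA d p hp)

section Counting

variable {V : Type*} [AddCommGroup V] [DecidableEq V]

theorem RR_sub (A : Finset V) (d : V) : RR A d ⊆ A := filter_subset _ _

theorem RR_card_le (A : Finset V) (d : V) : (RR A d).card ≤ A.card := card_le_card (RR_sub A d)

/-- number of pairs -/
theorem RR_sum_le (A F : Finset V) : ∑ d ∈ F, (RR A d).card ≤ A.card ^ 2 := by
  rw [← card_sigma, sq, ← card_product]
  apply card_le_card_of_injOn (fun z => (z.2, z.2 - z.1))
  · intro z hz
    simp only [coe_sigma, Set.mem_sigma_iff, mem_coe, RR, mem_filter] at hz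
    simp only [coe_product, Set.mem_prod, mem_coe]
    exact ⟨hz.2.1, hz.2.2⟩
  · rintro ⟨d, x⟩ _ ⟨d', x'⟩ _ h
    simp only [Prod.mk.injEq] at h
    obtain ⟨rfl, h⟩ := h
    have : d = d' := sub_right_injective h
    rw [this]

theorem kst (A F : Finset V)
    (hP : ∀ d ∈ F, ∀ d' ∈ F, d ≠ d' → (RR A d ∩ RR A d').card ≤ 2) :
    (∑ d ∈ F, (RR A d).card) ^ 2 ≤ A.card * (∑ d ∈ F, (RR A d).card + 2 * F.card ^ 2) := by
  have h1 : ∀ B : Finset V, B ⊆ A → B.card = ∑ x ∈ A, if x ∈ B then 1 else 0 := by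
    intro B hB
    rw [← card_filter]
    congr 1
    ext x; simp only [mem_filter]
    exact ⟨fun h => ⟨hB h, h⟩, fun h => h.2⟩
  have h2 : ∑ d ∈ F, (RR A d).card = ∑ x ∈ A, ∑ d ∈ F, if x ∈ RR A d then 1 else 0 := by
    rw [sum_comm]
    exact sum_congr rfl (fun d _ => h1 _ (RR_sub A d))
  have h3 : ∑ x ∈ A, (∑ d ∈ F, if x ∈ RR A d then 1 else 0) ^ 2
      = ∑ d ∈ F, ∑ d' ∈ F, (RR A d ∩ RR A d').card := by
    have : ∀ d ∈ F, ∑ d' ∈ F, (RR A d ∩ RR A d').card = ∑ x ∈ A, ∑ d' ∈ F,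
        (if x ∈ RR A d then 1 else 0) * (if x ∈ RR A d' then 1 else 0) := by
      intro d _
      rw [sum_comm]
      refine sum_congr rfl (fun d' _ => ?_)
      rw [h1 _ (inter_subset_left.trans (RR_sub A d))]
      refine sum_congr rfl (fun x _ => ?_)
      by_cases ha : x ∈ RR A d <;> by_cases hb : x ∈ RR A d' <;> simp [ha, hb]
    rw [sum_congr rfl this, sum_comm]
    refine sum_congr rfl (fun x _ => ?_)
    rw [sq, sum_mul_sum]
  have h4 : ∑ d ∈ F, ∑ d' ∈ F, (RR A d ∩ RR A d').card ≤ ∑ d ∈ F, (RR A d).card + 2 * F.card ^ 2 := by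
    calc _ ≤ ∑ d ∈ F, ((RR A d).card + 2 * F.card) := by
          refine sum_le_sum (fun d hd => ?_)
          calc _ ≤ ∑ d' ∈ F, ((if d = d' then (RR A d).card else 0) + 2) := by
                refine sum_le_sum (fun d' hd' => ?_)
                by_cases h : d = d'
                · subst h; simp
                · simp only [h, if_false]; have := hP d hd d' hd' h; omega
            _ = _ := by
                rw [sum_add_distrib, sum_ite_eq]; simp [hd, mul_comm]
      _ = _ := by rw [sum_add_distrib, sum_const, smul_eq_mul]; ring
  calc (∑ d ∈ F, (RR A d).card) ^ 2 ≤ A.card * ∑ x ∈ A, (∑ d ∈ F, if x ∈ RR A d then 1 else 0) ^ 2 := by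
        rw [h2]; exact sq_sum_le_card_mul_sum_sq
    _ ≤ _ := by rw [h3]; exact Nat.mul_le_mul_left _ h4

theorem kst_rich (A F : Finset V)
    (hP : ∀ d ∈ F, ∀ d' ∈ F, d ≠ d' → (RR A d ∩ RR A d').card ≤ 2) (t : ℕ)
    (ht : ∀ d ∈ F, t ≤ (RR A d).card) (h : 4 * A.card ≤ t ^ 2 ∨ 4 * F.card ≤ t) :
    F.card * t ≤ 2 * A.card := by
  have h1 := kst A F hP
  have h2 : F.card * t ≤ ∑ d ∈ F, (RR A d).card := by
    rw [← smul_eq_mul]; exact card_nsmul_le_sum _ _ _ ht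
  generalize ∑ d ∈ F, (RR A d).card = S at h1 h2
  generalize F.card = N at *
  generalize A.card = n at *
  refine h2.trans ?_
  rcases Nat.eq_zero_or_pos S with h0 | h0
  · omega
  rcases h with h | h
  · have h5 : 4 * (n * N ^ 2) ≤ S ^ 2 := by
      calc 4 * (n * N ^ 2) = N ^ 2 * (4 * n) := by ring
        _ ≤ N ^ 2 * t ^ 2 := Nat.mul_le_mul_left _ h
        _ = (N * t) ^ 2 := by ring
        _ ≤ S ^ 2 := Nat.pow_le_pow_left h2 2
    by_contra hc
    push Not at hc
    nlinarith
  · have h5 : 4 * N ^ 2 ≤ S := by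
      calc 4 * N ^ 2 = N * (4 * N) := by ring
        _ ≤ N * t := Nat.mul_le_mul_left _ h
        _ ≤ S := h2
    have h6 : 2 * (n * (S + 2 * N ^ 2)) ≤ 3 * n * S := by nlinarith
    by_contra hc
    push Not at hc
    nlinarith

/-- same-cell triples -/
def TT {K : Type*} [DecidableEq K] (c : V → K) (R : Finset V) : Finset (Finset V) :=
  (R.image c).biUnion (fun k => powersetCard 3 (R.filter (fun x => c x = k)))

theorem TT_card {K : Type*} [DecidableEq K] (c : V → K) (R : Finset V) :
    (TT c R).card = ∑ k ∈ R.image c, (R.filter (fun x => c x = k)).card.choose 3 := by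
  unfold TT
  rw [card_biUnion]
  · exact sum_congr rfl (fun k _ => card_powersetCard _ _)
  · intro k _ k' _ hkk
    rw [Function.onFun, disjoint_left]
    intro t ht ht'
    rw [mem_powersetCard] at ht ht'
    obtain ⟨x, hx⟩ : t.Nonempty := card_pos.1 (by omega)
    have e1 := (mem_filter.1 (ht.1 hx)).2
    have e2 := (mem_filter.1 (ht'.1 hx)).2
    exact hkk (e1.symm.trans e2)

theorem sub_two_le_choose (m : ℕ) : m ≤ m.choose 3 + 2 := by
  induction m with
  | zero => simp
  | succ k ih =>
    rcases Nat.lt_or_ge k 2 with h | h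
    · omega
    · have : 0 < k.choose 2 := Nat.choose_pos h
      have e : (k+1).choose 3 = k.choose 2 + k.choose 3 := Nat.choose_succ_succ k 2
      omega

theorem TT_lower {K : Type*} [DecidableEq K] (c : V → K) (R : Finset V) :
    R.card ≤ (TT c R).card + 2 * (R.image c).card := by
  rw [TT_card, card_eq_sum_card_image c R]
  calc _ ≤ ∑ k ∈ R.image c, ((R.filter (fun x => c x = k)).card.choose 3 + 2) :=
        sum_le_sum (fun k _ => sub_two_le_choose _)
    _ = _ := by rw [sum_add_distrib, sum_const, smul_eq_mul]; ring

theorem TT_upper {K : Type*} [DecidableEq K] (c : V → K) (A : Finset V) (s : ℕ)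
    (hs : ∀ k, (A.filter (fun x => c x = k)).card ≤ s) : (TT c A).card ≤ A.card * s ^ 2 := by
  rw [TT_card, card_eq_sum_card_image c A, sum_mul]
  refine sum_le_sum (fun k _ => ?_)
  refine (Nat.choose_le_pow _ 3).trans ?_
  rw [pow_succ' _ 2]
  exact Nat.mul_le_mul_left _ (Nat.pow_le_pow_left (hs k) 2)

theorem TT_mem {K : Type*} [DecidableEq K] (c : V → K) (R : Finset V) (t : Finset V) (ht : t ∈ TT c R) :
    t ⊆ R ∧ t.card = 3 := by
  simp only [TT, mem_biUnion, mem_powersetCard] at ht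
  obtain ⟨k, _, h1, h2⟩ := ht
  exact ⟨h1.trans (filter_subset _ _), h2⟩

theorem TT_mono {K : Type*} [DecidableEq K] (c : V → K) (R A : Finset V) (h : R ⊆ A) : TT c R ⊆ TT c A := by
  intro t ht
  simp only [TT, mem_biUnion, mem_powersetCard] at ht ⊢
  obtain ⟨k, h0, h1, h2⟩ := ht
  exact ⟨k, image_subset_image h h0, h1.trans (filter_subset_filter _ h), h2⟩

theorem TT_sum {K : Type*} [DecidableEq K] (c : V → K) (A F : Finset V)
    (hP : ∀ d ∈ F, ∀ d' ∈ F, d ≠ d' → (RR A d ∩ RR A d').card ≤ 2) :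
    ∑ d ∈ F, (TT c (RR A d)).card ≤ (TT c A).card := by
  rw [← card_biUnion]
  · apply card_le_card
    rw [biUnion_subset]
    exact fun d _ => TT_mono c _ _ (RR_sub A d)
  · intro d hd d' hd' hne
    rw [Function.onFun, disjoint_left]
    intro t ht ht'
    have h1 := TT_mem _ _ _ ht
    have h2 := TT_mem _ _ _ ht'
    have := card_le_card (subset_inter h1.1 h2.1)
    have := hP d hd d' hd' hne
    omega

/-- the two geometric inputs -/
structure Geo (A : Finset V) : Prop where
  P1 : ∀ d d' : V, d ≠ 0 → d' ≠ 0 → d ≠ d' → (RR A d ∩ RR A d').card ≤ 2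
  P2 : ∀ (F : Finset V), (∀ d ∈ F, d ≠ 0) → ∀ r : ℕ, 1 ≤ r → r ≤ F.card →
    ∃ cell : V → ℕ × ℕ, (∀ key, (A.filter (fun x => cell x = key)).card ≤ A.card / r^2 + 1) ∧
      ∑ d ∈ F, ((RR A d).image cell).card ≤ 44 * F.card * r

/-- common choice of cutting -/
theorem Geo.cut {A : Finset V} (hA : Geo A) (F : Finset V) (hF : ∀ d ∈ F, d ≠ 0) (t : ℕ)
    (h1 : 176 ≤ t) (h2 : t ^ 2 < 4 * A.card) (h3 : t < 4 * F.card) :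
    ∃ (cell : V → ℕ × ℕ) (s : ℕ), (∀ key, (A.filter (fun x => cell x = key)).card ≤ s) ∧
      s * t ^ 2 ≤ 2 * 352 ^ 2 * A.card ∧
      4 * ∑ d ∈ F, ((RR A d).image cell).card ≤ F.card * t := by
  have hr : 1 ≤ t / 176 := by omega
  obtain ⟨cell, hc1, hc2⟩ := hA.P2 F hF (t / 176) hr (by omega)
  refine ⟨cell, _, hc1, ?_, ?_⟩
  · have e1 : t ≤ 352 * (t / 176) := by omega
    have e2 : t / 176 * 176 ≤ t := Nat.div_mul_le_self _ _
    generalize t / 176 = r at *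
    have e3 : r ^ 2 ≤ A.card := by nlinarith
    have e4 : A.card / r ^ 2 * r ^ 2 ≤ A.card := Nat.div_mul_le_self _ _
    generalize A.card / r ^ 2 = q at *
    calc (q + 1) * t ^ 2 ≤ (q + 1) * (352 * r) ^ 2 := by gcongr
      _ = 352 ^ 2 * (q * r ^ 2 + r ^ 2) := by ring
      _ ≤ 352 ^ 2 * (A.card + A.card) := by gcongr
      _ = _ := by ring
  · calc 4 * ∑ d ∈ F, ((RR A d).image cell).card ≤ 4 * (44 * F.card * (t / 176)) := by gcongr
      _ = F.card * (t / 176 * 176) := by ring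
      _ ≤ F.card * t := Nat.mul_le_mul_left _ (Nat.div_mul_le_self _ _)

theorem lemma_one {A : Finset V} (hA : Geo A) (F : Finset V) (hF : ∀ d ∈ F, d ≠ 0) (t : ℕ)
    (ht : ∀ d ∈ F, t ≤ (RR A d).card) :
    F.card * t ^ 5 ≤ 8 * 352 ^ 4 * A.card ^ 3 + 2 * A.card * t ^ 4 := by
  have hP : ∀ d ∈ F, ∀ d' ∈ F, d ≠ d' → (RR A d ∩ RR A d').card ≤ 2 :=
    fun d hd d' hd' h => hA.P1 d d' (hF d hd) (hF d' hd') h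
  have hS : F.card * t ≤ ∑ d ∈ F, (RR A d).card := by
    rw [← smul_eq_mul]; exact card_nsmul_le_sum _ _ _ ht
  by_cases h1 : 176 ≤ t
  · by_cases hk : 4 * A.card ≤ t ^ 2 ∨ 4 * F.card ≤ t
    · have := kst_rich A F hP t ht hk
      calc F.card * t ^ 5 = (F.card * t) * t ^ 4 := by ring
        _ ≤ 2 * A.card * t ^ 4 := by gcongr
        _ ≤ _ := Nat.le_add_left _ _
    · push Not at hk
      obtain ⟨cell, s, hc1, hs, hc2⟩ := hA.cut F hF t h1 hk.1 hk.2
      have e1 : ∑ d ∈ F, (RR A d).card ≤ A.card * s ^ 2 + 2 * ∑ d ∈ F, ((RR A d).image cell).card := by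
        calc _ ≤ ∑ d ∈ F, ((TT cell (RR A d)).card + 2 * ((RR A d).image cell).card) :=
              sum_le_sum (fun d _ => TT_lower cell _)
          _ ≤ _ := by
              rw [sum_add_distrib, ← mul_sum]
              exact Nat.add_le_add_right ((TT_sum cell A F hP).trans (TT_upper cell A s hc1)) _
      have e2 : F.card * t ≤ 2 * (A.card * s ^ 2) := by omega
      calc F.card * t ^ 5 = (F.card * t) * t ^ 4 := by ring
        _ ≤ (2 * (A.card * s ^ 2)) * t ^ 4 := by gcongr
        _ = 2 * A.card * (s * t ^ 2) ^ 2 := by ring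
        _ ≤ 2 * A.card * (2 * 352 ^ 2 * A.card) ^ 2 := by gcongr
        _ = 8 * 352 ^ 4 * A.card ^ 3 := by ring
        _ ≤ _ := Nat.le_add_right _ _
  · have h2 := hS.trans (RR_sum_le A F)
    have h3 : A.card ^ 2 ≤ A.card ^ 3 := by
      rcases Nat.eq_zero_or_pos A.card with h | h
      · simp [h]
      · exact Nat.pow_le_pow_right h (by norm_num)
    calc F.card * t ^ 5 = (F.card * t) * t ^ 4 := by ring
      _ ≤ A.card ^ 2 * 176 ^ 4 := by gcongr; omega
      _ ≤ A.card ^ 3 * 176 ^ 4 := by gcongr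
      _ ≤ 8 * 352 ^ 4 * A.card ^ 3 := by
        rw [mul_comm]; gcongr; norm_num
      _ ≤ _ := Nat.le_add_right _ _

theorem dyadic {ι : Type*} (G : Finset ι) (f : ι → ℕ) (n σ : ℕ) (hσ : 1 ≤ σ)
    (hf : ∀ x ∈ G, σ ≤ f x ∧ f x ≤ n) (B : ℝ)
    (hB : ∀ i : ℕ, ∑ x ∈ G.filter (fun x => 2 ^ i * σ ≤ f x ∧ f x < 2 * (2 ^ i * σ)), (f x : ℝ) ^ 2 ≤ B) :
    ∑ x ∈ G, (f x : ℝ) ^ 2 ≤ (Nat.log 2 n + 1 : ℕ) * B := by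
  have hmap : ∀ x ∈ G, Nat.log 2 (f x / σ) ∈ range (Nat.log 2 n + 1) := by
    intro x hx
    rw [mem_range, Nat.lt_succ_iff]
    exact Nat.log_mono_right ((Nat.div_le_self _ _).trans (hf x hx).2)
  rw [← sum_fiberwise_of_maps_to hmap]
  calc _ ≤ ∑ i ∈ range (Nat.log 2 n + 1), B := by
        refine sum_le_sum (fun i _ => le_trans ?_ (hB i))
        apply sum_le_sum_of_subset_of_nonneg
        · intro x hx
          rw [mem_filter] at hx ⊢
          obtain ⟨hx, rfl⟩ := hx
          have h0 : f x / σ ≠ 0 := by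
            have := Nat.div_pos (hf x hx).1 hσ
            omega
          have a1 := Nat.pow_log_le_self 2 h0
          have a2 := Nat.lt_pow_succ_log_self (b := 2) (by norm_num) (f x / σ)
          refine ⟨hx, (Nat.le_div_iff_mul_le hσ).1 a1, ?_⟩
          rw [Nat.div_lt_iff_lt_mul hσ] at a2
          rw [pow_succ] at a2
          linarith
        · intros; positivity
    _ = _ := by simp

end Counting

section Counting2

variable {V : Type*} [AddCommGroup V] [DecidableEq V]

/-- ordered same-cell pairs -/
def PP {K : Type*} [DecidableEq K] (c : V → K) (R : Finset V) : Finset (V × V) :=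
  (R ×ˢ R).filter (fun z => z.1 ≠ z.2 ∧ c z.1 = c z.2)

theorem PP_lower {K : Type*} [DecidableEq K] (c : V → K) (R : Finset V) :
    R.card ≤ (PP c R).card + (R.image c).card := by
  let g : K → V := Function.invFunOn c R
  have hg : ∀ x ∈ R, g (c x) ∈ R ∧ c (g (c x)) = c x := by
    intro x hx
    have h : ∃ a ∈ (R : Set V), c a = c x := ⟨x, hx, rfl⟩
    exact ⟨Function.invFunOn_mem h, Function.invFunOn_eq h⟩
  rw [← card_filter_add_card_filter_not (s := R) (fun x => x ≠ g (c x))]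
  apply Nat.add_le_add
  · apply card_le_card_of_injOn (fun x => (x, g (c x)))
    · intro x hx
      simp only [coe_filter, Set.mem_ofPred_eq] at hx
      simp only [PP, coe_filter, mem_product, Set.mem_ofPred_eq]
      exact ⟨⟨hx.1, (hg x hx.1).1⟩, hx.2, (hg x hx.1).2.symm⟩
    · intro x _ y _ h
      exact (Prod.mk.inj h).1
  · apply card_le_card_of_injOn c
    · intro x hx
      simp only [coe_filter, Set.mem_ofPred_eq] at hx
      exact mem_coe.2 (mem_image_of_mem c hx.1)
    · intro x hx y hy h
      simp only [coe_filter, Set.mem_ofPred_eq, not_not] at hx hy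
      rw [hx.2, hy.2, h]

theorem PP_upper {K : Type*} [DecidableEq K] (c : V → K) (A : Finset V) (s : ℕ)
    (hs : ∀ k, (A.filter (fun x => c x = k)).card ≤ s) : (PP c A).card ≤ A.card * s := by
  have h : ∀ z ∈ PP c A, z.1 ∈ A := by
    intro z hz; simp only [PP, mem_filter, mem_product] at hz; exact hz.1.1
  rw [card_eq_sum_card_fiberwise h]
  rw [← smul_eq_mul]
  refine sum_le_card_nsmul _ _ _ (fun x hx => ?_)
  refine le_trans (card_le_card_of_injOn (fun z => z.2) ?_ ?_) (hs (c x))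
  · intro z hz
    simp only [PP, coe_filter, mem_filter, mem_product, Set.mem_ofPred_eq] at hz ⊢
    refine ⟨hz.1.1.2, ?_⟩
    rw [← hz.1.2.2, hz.2]
  · intro z hz w hw h
    simp only [coe_filter, Set.mem_ofPred_eq] at hz hw
    exact Prod.ext (hz.2.trans hw.2.symm) h

theorem mult_le (A F : Finset V) (x y : V) :
    (F.filter (fun d => x ∈ RR A d ∧ y ∈ RR A d)).card ≤ (RR A (x - y)).card := by
  apply card_le_card_of_injOn (fun d => x - d)
  · intro d hd
    simp only [RR, coe_filter, mem_filter, Set.mem_ofPred_eq] at hd ⊢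
    refine ⟨hd.2.1.2, ?_⟩
    have : x - d - (x - y) = y - d := by abel
    rw [this]; exact hd.2.2.2
  · intro d _ d' _ h
    exact sub_right_injective h

/-- pair counting split into a low range, a middle range and a high range -/
theorem pair_split {K : Type*} [DecidableEq K] (c : V → K) (A F D : Finset V)
    (hD : ∀ x ∈ A, ∀ y ∈ A, x ≠ y → x - y ∈ D) (s σ κ : ℕ)
    (hs : ∀ k, (A.filter (fun x => c x = k)).card ≤ s) :
    ∑ d ∈ F, (PP c (RR A d)).card ≤ σ * (A.card * s)
      + ∑ e ∈ D.filter (fun e => σ ≤ (RR A e).card ∧ (RR A e).card < κ), (RR A e).card ^ 2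
      + ∑ d ∈ F, ∑ e ∈ D.filter (fun e => κ ≤ (RR A e).card), (RR A d ∩ RR A e).card := by
  have hsub : ∀ d ∈ F, (PP c (RR A d)).card ≤
      ((PP c A).filter (fun z => (z.1 ∈ RR A d ∧ z.2 ∈ RR A d) ∧ (RR A (z.1 - z.2)).card < κ)).card
      + ∑ e ∈ D.filter (fun e => κ ≤ (RR A e).card), (RR A d ∩ RR A e).card := by
    intro d _
    rw [← card_filter_add_card_filter_not (s := PP c (RR A d)) (fun z => (RR A (z.1 - z.2)).card < κ)]
    apply Nat.add_le_add
    · apply card_le_card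
      intro z hz
      simp only [PP, mem_filter, mem_product] at hz ⊢
      exact ⟨⟨⟨RR_sub A d hz.1.1.1, RR_sub A d hz.1.1.2⟩, hz.1.2⟩, hz.1.1, hz.2⟩
    · rw [← card_sigma]
      apply card_le_card_of_injOn (fun z => ⟨z.1 - z.2, z.1⟩)
      · intro z hz
        simp only [PP, coe_filter, mem_filter, mem_product, Set.mem_ofPred_eq, not_lt] at hz
        simp only [coe_sigma, Set.mem_sigma_iff, mem_coe, mem_filter, mem_inter]
        have a1 := RR_sub A d hz.1.1.1
        have a2 := RR_sub A d hz.1.1.2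
        refine ⟨⟨hD _ a1 _ a2 hz.1.2.1, hz.2⟩, hz.1.1.1, ?_⟩
        simp only [RR, mem_filter]
        exact ⟨a1, by simpa using a2⟩
      · rintro ⟨x, y⟩ _ ⟨x', y'⟩ _ h
        simp only [Sigma.mk.injEq, heq_eq_eq] at h
        obtain ⟨h, rfl⟩ := h
        rw [sub_right_injective h]
  have hswap : ∑ d ∈ F, ((PP c A).filter (fun z => (z.1 ∈ RR A d ∧ z.2 ∈ RR A d) ∧ (RR A (z.1 - z.2)).card < κ)).card
      ≤ ∑ z ∈ PP c A, if (RR A (z.1 - z.2)).card < κ then (RR A (z.1 - z.2)).card else 0 := by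
    simp only [card_filter]
    rw [sum_comm]
    refine sum_le_sum (fun z _ => ?_)
    by_cases h : (RR A (z.1 - z.2)).card < κ
    · simp only [h, and_true, if_true]
      rw [← card_filter]
      exact mult_le A F z.1 z.2
    · simp [h]
  have hlow : ∑ z ∈ PP c A, (if (RR A (z.1 - z.2)).card < κ then (RR A (z.1 - z.2)).card else 0)
      ≤ σ * (A.card * s) + ∑ z ∈ (PP c A).filter (fun z => σ ≤ (RR A (z.1 - z.2)).card ∧ (RR A (z.1 - z.2)).card < κ),
          (RR A (z.1 - z.2)).card := by
    calc _ ≤ ∑ z ∈ PP c A, (σ + if (σ ≤ (RR A (z.1 - z.2)).card ∧ (RR A (z.1 - z.2)).card < κ) then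
            (RR A (z.1 - z.2)).card else 0) := by
          refine sum_le_sum (fun z _ => ?_)
          split_ifs <;> omega
      _ ≤ _ := by
          rw [sum_add_distrib, sum_const, smul_eq_mul, mul_comm, sum_filter]
          exact Nat.add_le_add_right (Nat.mul_le_mul_left _ (PP_upper c A s hs)) _
  have hmid : ∑ z ∈ (PP c A).filter (fun z => σ ≤ (RR A (z.1 - z.2)).card ∧ (RR A (z.1 - z.2)).card < κ),
          (RR A (z.1 - z.2)).card
      ≤ ∑ e ∈ D.filter (fun e => σ ≤ (RR A e).card ∧ (RR A e).card < κ), (RR A e).card ^ 2 := by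
    have hm : ∀ z ∈ (PP c A).filter (fun z => σ ≤ (RR A (z.1 - z.2)).card ∧ (RR A (z.1 - z.2)).card < κ),
        z.1 - z.2 ∈ D.filter (fun e => σ ≤ (RR A e).card ∧ (RR A e).card < κ) := by
      intro z hz
      simp only [PP, mem_filter, mem_product] at hz ⊢
      exact ⟨hD _ hz.1.1.1 _ hz.1.1.2 hz.1.2.1, hz.2⟩
    rw [← sum_fiberwise_of_maps_to hm]
    refine sum_le_sum (fun e _ => ?_)
    rw [sum_congr rfl (g := fun _ => (RR A e).card) (by
      intro z hz; rw [(mem_filter.1 hz).2]), sum_const, smul_eq_mul, sq]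
    apply Nat.mul_le_mul_right
    apply card_le_card_of_injOn (fun z => z.1)
    · intro z hz
      replace hz := mem_coe.1 hz
      simp only [PP, mem_filter, mem_product] at hz
      simp only [RR, coe_filter, Set.mem_ofPred_eq]
      rw [← hz.2]
      exact ⟨hz.1.1.1.1, by simpa using hz.1.1.1.2⟩
    · intro z hz w hw h
      simp only [coe_filter, Set.mem_ofPred_eq] at hz hw
      have h : z.1 = w.1 := h
      have e := hz.2.trans hw.2.symm
      rw [h] at e
      exact Prod.ext h (sub_right_injective e)
  calc _ ≤ ∑ d ∈ F, _ := sum_le_sum hsub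
    _ ≤ _ := by
      rw [sum_add_distrib]
      exact Nat.add_le_add_right (hswap.trans (hlow.trans (Nat.add_le_add_left hmid _))) _

/-- bound for a dyadic range of multiplicities -/
theorem level_one {A : Finset V} (hA : Geo A) (G : Finset V) (hG : ∀ d ∈ G, d ≠ 0) (σ t κ : ℕ)
    (hσ : 1 ≤ σ) (hσt : σ ≤ t) (hGt : ∀ e ∈ G, t ≤ (RR A e).card ∧ (RR A e).card < 2 * t)
    (hκ : ∀ e ∈ G, (RR A e).card < κ) :
    ∑ e ∈ G, ((RR A e).card : ℝ) ^ 2 ≤ 32 * 352 ^ 4 * (A.card : ℝ) ^ 3 / σ ^ 3 + 8 * A.card * κ := by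
  rcases G.eq_empty_or_nonempty with rfl | ⟨e0, he0⟩
  · simp only [sum_empty]; positivity
  have htκ : t ≤ κ := ((hGt e0 he0).1.trans_lt (hκ e0 he0)).le
  have h1 := lemma_one hA G hG t (fun e he => (hGt e he).1)
  have h2 : ∑ e ∈ G, ((RR A e).card : ℝ) ^ 2 ≤ G.card * (4 * (t : ℝ) ^ 2) := by
    rw [← nsmul_eq_mul]
    refine sum_le_card_nsmul _ _ _ (fun e he => ?_)
    have : ((RR A e).card : ℝ) ≤ 2 * t := by exact_mod_cast (hGt e he).2.le
    calc ((RR A e).card : ℝ) ^ 2 ≤ (2 * t) ^ 2 := by gcongr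
      _ = _ := by ring
  have h1' : (G.card : ℝ) * t ^ 5 ≤ 8 * 352 ^ 4 * (A.card : ℝ) ^ 3 + 2 * A.card * t ^ 4 := by
    exact_mod_cast h1
  have hs0 : (0:ℝ) < σ := by exact_mod_cast hσ
  have ht0 : (0:ℝ) < t := by exact_mod_cast (lt_of_lt_of_le hσ hσt)
  have hst : (σ : ℝ) ≤ t := by exact_mod_cast hσt
  have htk : (t : ℝ) ≤ κ := by exact_mod_cast htκ
  refine h2.trans ?_
  have h3 : (G.card : ℝ) * t ^ 2 ≤ 8 * 352 ^ 4 * (A.card : ℝ) ^ 3 / t ^ 3 + 2 * A.card * t := by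
    rw [← mul_le_mul_iff_left₀ (pow_pos ht0 3)]
    rw [add_mul, div_mul_cancel₀ _ (pow_pos ht0 3).ne']
    linarith
  calc (G.card : ℝ) * (4 * (t : ℝ) ^ 2) = 4 * (G.card * t ^ 2) := by ring
    _ ≤ 4 * (8 * 352 ^ 4 * (A.card : ℝ) ^ 3 / t ^ 3 + 2 * A.card * t) := by gcongr
    _ ≤ 4 * (8 * 352 ^ 4 * (A.card : ℝ) ^ 3 / σ ^ 3 + 2 * A.card * κ) := by gcongr
    _ = _ := by ring

theorem middle_sum {A : Finset V} (hA : Geo A) (G : Finset V) (hG : ∀ d ∈ G, d ≠ 0) (σ κ : ℕ)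
    (hσ : 1 ≤ σ) (hGt : ∀ e ∈ G, σ ≤ (RR A e).card ∧ (RR A e).card < κ) :
    ∑ e ∈ G, ((RR A e).card : ℝ) ^ 2 ≤
      (Nat.log 2 A.card + 1 : ℕ) * (32 * 352 ^ 4 * (A.card : ℝ) ^ 3 / σ ^ 3 + 8 * A.card * κ) := by
  apply dyadic G (fun e => (RR A e).card) A.card σ hσ (fun e he => ⟨(hGt e he).1, RR_card_le A e⟩)
  intro i
  apply level_one hA _ (fun d hd => hG d (mem_filter.1 hd).1) σ (2 ^ i * σ) κ hσ
  · exact Nat.le_mul_of_pos_left _ (by positivity)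
  · exact fun e he => (mem_filter.1 he).2
  · exact fun e he => (hGt e (mem_filter.1 he).1).2

theorem lemma_two {A : Finset V} (hA : Geo A) (F : Finset V) (hF : ∀ d ∈ F, d ≠ 0) (t σ : ℕ)
    (hσ : 1 ≤ σ) (hFt : ∀ d ∈ F, t ≤ (RR A d).card ∧ (RR A d).card < 2 * t)
    (h1 : 176 ≤ t) (h2 : t ^ 2 < 4 * A.card) (h3 : t < 4 * F.card) :
    (F.card : ℝ) * t ^ 2 ≤ 4 * 352 ^ 2 * σ * (A.card : ℝ) ^ 2 / t +
      (Nat.log 2 A.card + 1 : ℕ) * (64 * 352 ^ 4 * (A.card : ℝ) ^ 3 * t / σ ^ 3 + 288 * (A.card : ℝ) ^ 2) := by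
  obtain ⟨cell, s, hc1, hs, hc2⟩ := hA.cut F hF t h1 h2 h3
  let D : Finset V := (image (fun z : V × V => z.1 - z.2) (A ×ˢ A)).erase 0
  have hD0 : ∀ d ∈ D, d ≠ 0 := fun d hd => (mem_erase.1 hd).1
  have hD : ∀ x ∈ A, ∀ y ∈ A, x ≠ y → x - y ∈ D := by
    intro x hx y hy hne
    refine mem_erase.2 ⟨sub_ne_zero.2 hne, mem_image.2 ⟨(x, y), mem_product.2 ⟨hx, hy⟩, rfl⟩⟩
  obtain ⟨κ, hκ⟩ : ∃ κ, κ = 16 * A.card / t + 1 := ⟨_, rfl⟩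
  have ht0 : 0 < t := by omega
  have hκ1 : 16 * A.card ≤ κ * t := by
    have := Nat.lt_div_mul_add (a := 16 * A.card) ht0
    rw [hκ, add_mul, one_mul]; exact this.le
  have hκ2 : κ * t ≤ 18 * A.card := by
    have := Nat.div_mul_le_self (16 * A.card) t
    rw [hκ, add_mul, one_mul]
    have : 2 * t ≤ t ^ 2 := by nlinarith
    omega
  have hκ3 : 2 * t ≤ κ := by
    by_contra hc
    push Not at hc
    nlinarith
  have hκ4 : 4 * A.card ≤ κ ^ 2 := by
    by_contra hc
    push Not at hc
    have a1 : κ ^ 2 * t ^ 2 ≤ (4 * A.card) * (4 * A.card) := Nat.mul_le_mul hc.le h2.le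
    have a2 : (16 * A.card) ^ 2 ≤ (κ * t) ^ 2 := Nat.pow_le_pow_left hκ1 2
    have a3 : 0 < A.card := by omega
    nlinarith
  have hsplit := pair_split cell A F D hD s σ κ hc1
  have hlow : F.card * t ≤ ∑ d ∈ F, (PP cell (RR A d)).card + ∑ d ∈ F, ((RR A d).image cell).card := by
    rw [← sum_add_distrib, ← smul_eq_mul]
    exact card_nsmul_le_sum _ _ _ (fun d hd => (hFt d hd).1.trans (PP_lower cell _))
  obtain ⟨G3, hG3⟩ : ∃ G3, G3 = D.filter (fun e => κ ≤ (RR A e).card) := ⟨_, rfl⟩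
  have hG3κ : ∀ e ∈ G3, κ ≤ (RR A e).card := fun e he => by rw [hG3] at he; exact (mem_filter.1 he).2
  have hG30 : ∀ e ∈ G3, e ≠ 0 := fun e he => by rw [hG3] at he; exact hD0 e (mem_filter.1 he).1
  have hG3c : G3.card * κ ≤ 2 * A.card :=
    kst_rich A G3 (fun d hd d' hd' h => hA.P1 d d' (hG30 d hd) (hG30 d' hd') h) κ hG3κ (Or.inl hκ4)
  have hhigh : ∑ d ∈ F, ∑ e ∈ G3, (RR A d ∩ RR A e).card ≤ F.card * (G3.card * 2) := by
    rw [← smul_eq_mul, ← smul_eq_mul]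
    refine sum_le_card_nsmul _ _ _ (fun d hd => sum_le_card_nsmul _ _ _ (fun e he => ?_))
    apply hA.P1 d e (hF d hd) (hG30 e he)
    rintro rfl
    have := hG3κ d he
    have := (hFt d hd).2
    omega
  have hG3t : G3.card * 8 ≤ t := by
    have a3 : 0 < A.card := by omega
    have : (G3.card * 8) * (κ * t) ≤ t * (κ * t) := by
      calc (G3.card * 8) * (κ * t) = 8 * t * (G3.card * κ) := by ring
        _ ≤ 8 * t * (2 * A.card) := by gcongr
        _ = t * (16 * A.card) := by ring
        _ ≤ t * (κ * t) := by gcongr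
    exact Nat.le_of_mul_le_mul_right this (by omega)
  have hhigh2 : 4 * ∑ d ∈ F, ∑ e ∈ G3, (RR A d ∩ RR A e).card ≤ F.card * t := by
    calc _ ≤ 4 * (F.card * (G3.card * 2)) := by gcongr
      _ = F.card * (G3.card * 8) := by ring
      _ ≤ _ := by gcongr
  rw [← hG3] at hsplit
  have hmid := middle_sum hA (D.filter (fun e => σ ≤ (RR A e).card ∧ (RR A e).card < κ))
    (fun d hd => hD0 d (mem_filter.1 hd).1) σ κ hσ (fun e he => (mem_filter.1 he).2)
  obtain ⟨M, hM⟩ : ∃ M, M = ∑ e ∈ D.filter (fun e => σ ≤ (RR A e).card ∧ (RR A e).card < κ), (RR A e).card ^ 2 :=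
    ⟨_, rfl⟩
  have hM' : (M : ℝ) = ∑ e ∈ D.filter (fun e => σ ≤ (RR A e).card ∧ (RR A e).card < κ), ((RR A e).card : ℝ) ^ 2 := by
    rw [hM]; push_cast; rfl
  rw [← hM] at hsplit
  rw [← hM'] at hmid
  have hmain : F.card * t ≤ 2 * (σ * (A.card * s)) + 2 * M := by omega
  have hmain' : (F.card : ℝ) * t ≤ 2 * (σ * (A.card * s)) + 2 * M := by exact_mod_cast hmain
  have hs' : (s : ℝ) * t ^ 2 ≤ 2 * 352 ^ 2 * A.card := by exact_mod_cast hs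
  have hκ2' : (κ : ℝ) * t ≤ 18 * A.card := by exact_mod_cast hκ2
  have ht0' : (0 : ℝ) < t := by exact_mod_cast ht0
  have hσ' : (0 : ℝ) < σ := by exact_mod_cast hσ
  generalize hJdef : ((Nat.log 2 A.card + 1 : ℕ) : ℝ) = J at *
  have hJ : 0 ≤ J := by
    rw [← hJdef]; positivity
  have b1 : (s : ℝ) * t ≤ 2 * 352 ^ 2 * A.card / t := by
    rw [le_div_iff₀ ht0']; linarith
  have hJ0 : 16 * A.card * (κ * t) ≤ 16 * A.card * (18 * (A.card : ℝ)) := by gcongr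
  calc (F.card : ℝ) * t ^ 2 = (F.card * t) * t := by ring
    _ ≤ (2 * (σ * (A.card * s)) + 2 * M) * t := by gcongr
    _ = 2 * σ * A.card * (s * t) + 2 * t * M := by ring
    _ ≤ 2 * σ * A.card * (2 * 352 ^ 2 * A.card / t)
        + 2 * t * (J * (32 * 352 ^ 4 * (A.card : ℝ) ^ 3 / σ ^ 3 + 8 * A.card * κ)) := by gcongr
    _ = 4 * 352 ^ 2 * σ * (A.card : ℝ) ^ 2 / t +
      J * (64 * 352 ^ 4 * (A.card : ℝ) ^ 3 * t / σ ^ 3 + 16 * A.card * (κ * t)) := by ring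
    _ ≤ 4 * 352 ^ 2 * σ * (A.card : ℝ) ^ 2 / t +
      J * (64 * 352 ^ 4 * (A.card : ℝ) ^ 3 * t / σ ^ 3 + 16 * A.card * (18 * A.card)) := by gcongr
    _ = _ := by ring

end Counting2

section Final

variable {V : Type*} [AddCommGroup V] [DecidableEq V]

theorem log_bound (n : ℕ) (y : ℝ) (hy : 1 ≤ y) (hn : (n : ℝ) = y ^ 36) :
    ((Nat.log 2 n + 1 : ℕ) : ℝ) ≤ 60 * y := by
  have hn0 : n ≠ 0 := by
    rintro rfl
    have : (0:ℝ) < y ^ 36 := by positivity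
    simp at hn; linarith
  have h1 : (2:ℝ) ^ Nat.log 2 n ≤ y ^ 36 := by
    rw [← hn]; exact_mod_cast Nat.pow_log_le_self 2 hn0
  have h2 := Real.log_le_log (by positivity) h1
  rw [Real.log_pow, Real.log_pow] at h2
  have h3 := Real.log_le_sub_one_of_pos (x := y) (by linarith)
  have h4 := Real.log_two_gt_d9
  push_cast at h2 ⊢
  have h5 : (0:ℝ) ≤ Nat.log 2 n := Nat.cast_nonneg _
  nlinarith

theorem level_two {A : Finset V} (hA : Geo A) (F : Finset V) (hF : ∀ d ∈ F, d ≠ 0) (t : ℕ)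
    (hFt : ∀ d ∈ F, t ≤ (RR A d).card ∧ (RR A d).card < 2 * t)
    (y : ℝ) (hy : 1 ≤ y) (hn : (A.card : ℝ) = y ^ 36) (hty : y ^ 8 ≤ t) :
    ∑ d ∈ F, ((RR A d).card : ℝ) ^ 2 ≤ 10 ^ 15 * y ^ 78 := by
  rcases F.eq_empty_or_nonempty with rfl | ⟨e0, he0⟩
  · simp only [sum_empty]; positivity
  have htn : t ≤ A.card := (hFt e0 he0).1.trans (RR_card_le A e0)
  have htn' : (t : ℝ) ≤ A.card := by exact_mod_cast htn
  have h2 : ∑ e ∈ F, ((RR A e).card : ℝ) ^ 2 ≤ 4 * (F.card * (t : ℝ) ^ 2) := by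
    rw [mul_left_comm, ← nsmul_eq_mul]
    refine sum_le_card_nsmul _ _ _ (fun e he => ?_)
    have : ((RR A e).card : ℝ) ≤ 2 * t := by exact_mod_cast (hFt e he).2.le
    calc ((RR A e).card : ℝ) ^ 2 ≤ (2 * t) ^ 2 := by gcongr
      _ = _ := by ring
  refine h2.trans ?_
  have hy0 : 0 < y := by linarith
  have hn2 : (A.card : ℝ) ^ 2 = y ^ 72 := by rw [hn]; ring
  have hn3 : (A.card : ℝ) ^ 3 = y ^ 108 := by rw [hn]; ring
  have p72 : y ^ 72 ≤ y ^ 78 := pow_le_pow_right₀ hy (by norm_num)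
  have p77 : y ^ 77 ≤ y ^ 78 := pow_le_pow_right₀ hy (by norm_num)
  have p72' : y ^ 72 ≤ y ^ 77 := pow_le_pow_right₀ hy (by norm_num)
  have q78 : 0 < y ^ 78 := by positivity
  have hS : F.card * t ≤ A.card ^ 2 := by
    refine le_trans ?_ (RR_sum_le A F)
    rw [← smul_eq_mul]; exact card_nsmul_le_sum _ _ _ (fun d hd => (hFt d hd).1)
  by_cases h1 : 176 ≤ t
  · by_cases hk : 4 * A.card ≤ t ^ 2 ∨ 4 * F.card ≤ t
    · have := kst_rich A F (fun d hd d' hd' h => hA.P1 d d' (hF d hd) (hF d' hd') h) t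
        (fun d hd => (hFt d hd).1) hk
      have this' : (F.card : ℝ) * t ≤ 2 * A.card := by exact_mod_cast this
      calc 4 * ((F.card : ℝ) * (t : ℝ) ^ 2) = 4 * ((F.card * t) * t) := by ring
        _ ≤ 4 * ((2 * A.card) * A.card) := by gcongr
        _ = 8 * (A.card : ℝ) ^ 2 := by ring
        _ ≤ _ := by rw [hn2]; linarith
    · push Not at hk
      obtain ⟨m, hm⟩ : ∃ m, m = ⌈y ^ 5⌉₊ := ⟨_, rfl⟩
      have y5 : 1 ≤ y ^ 5 := one_le_pow₀ hy
      have hm1 : y ^ 5 ≤ m := by rw [hm]; exact Nat.le_ceil _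
      have hm2 : (m : ℝ) ≤ 2 * y ^ 5 := by
        have := (Nat.ceil_lt_add_one (a := y ^ 5) (by positivity)).le
        rw [← hm] at this; linarith
      have hm0 : 0 < m := by
        rw [hm]; exact Nat.ceil_pos.2 (by positivity)
      have ht0 : 0 < t := by omega
      have h := lemma_two hA F hF t (t * m) (Nat.mul_pos ht0 hm0) hFt h1 hk.1 hk.2
      have ht0' : (0:ℝ) < t := by exact_mod_cast ht0
      have hm0' : (0:ℝ) < m := by exact_mod_cast hm0
      have hJ := log_bound A.card y hy hn
      rw [hn2, hn3] at h
      push_cast at h hJ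
      generalize ((Nat.log 2 A.card : ℝ) + 1) = J at *
      have t1 : 4 * 352 ^ 2 * ((t : ℝ) * m) * y ^ 72 / t ≤ 8 * 352 ^ 2 * y ^ 77 := by
        calc 4 * 352 ^ 2 * ((t : ℝ) * m) * y ^ 72 / t = 4 * 352 ^ 2 * m * y ^ 72 := by field_simp
          _ ≤ 4 * 352 ^ 2 * (2 * y ^ 5) * y ^ 72 := by gcongr
          _ = _ := by ring
      have t2 : 64 * 352 ^ 4 * y ^ 108 * (t:ℝ) / (t * m) ^ 3 ≤ 64 * 352 ^ 4 * y ^ 77 := by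
        rw [div_le_iff₀ (by positivity)]
        calc 64 * 352 ^ 4 * y ^ 108 * (t:ℝ) = 64 * 352 ^ 4 * y ^ 77 * (t * (y ^ 8) ^ 2 * (y ^ 5) ^ 3) := by ring
          _ ≤ 64 * 352 ^ 4 * y ^ 77 * (t * t ^ 2 * m ^ 3) := by gcongr
          _ = _ := by ring
      have t3 : J * (64 * 352 ^ 4 * y ^ 108 * (t:ℝ) / (t * m) ^ 3 + 288 * y ^ 72)
          ≤ (60 * y) * (64 * 352 ^ 4 * y ^ 77 + 288 * y ^ 77) := by gcongr
      have t4 : (60 * y) * (64 * 352 ^ 4 * y ^ 77 + 288 * y ^ 77) = 60 * (64 * 352 ^ 4 + 288) * y ^ 78 := by ring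
      linarith
  · have hS' : (F.card : ℝ) * t ≤ (A.card : ℝ) ^ 2 := by exact_mod_cast hS
    have h1' : (t : ℝ) ≤ 176 := by exact_mod_cast (by omega : t ≤ 176)
    calc 4 * ((F.card : ℝ) * (t : ℝ) ^ 2) = 4 * ((F.card * t) * t) := by ring
      _ ≤ 4 * ((A.card : ℝ) ^ 2 * 176) := by gcongr
      _ ≤ _ := by rw [hn2]; linarith

set_option maxHeartbeats 1000000 in
theorem energy_bound {A : Finset V} (hA : Geo A) (D : Finset V)
    (y : ℝ) (hy : 1 ≤ y) (hn : (A.card : ℝ) = y ^ 36) :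
    ∑ d ∈ D, ((RR A d).card : ℝ) ^ 2 ≤ 10 ^ 17 * y ^ 80 := by
  obtain ⟨σ, hσ⟩ : ∃ σ, σ = ⌈y ^ 8⌉₊ := ⟨_, rfl⟩
  have y8 : 1 ≤ y ^ 8 := one_le_pow₀ hy
  have hs1 : y ^ 8 ≤ σ := by rw [hσ]; exact Nat.le_ceil _
  have hs2 : (σ : ℝ) ≤ 2 * y ^ 8 := by
    have := (Nat.ceil_lt_add_one (a := y ^ 8) (by positivity)).le
    rw [← hσ] at this; linarith
  have hs0 : 1 ≤ σ := by
    have : (1:ℝ) ≤ σ := by linarith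
    exact_mod_cast this
  have hn2 : (A.card : ℝ) ^ 2 = y ^ 72 := by rw [hn]; ring
  let G := D.filter (fun d => d ≠ 0 ∧ σ ≤ (RR A d).card)
  have hG : ∑ d ∈ G, ((RR A d).card : ℝ) ^ 2 ≤ (Nat.log 2 A.card + 1 : ℕ) * (10 ^ 15 * y ^ 78) := by
    apply dyadic G (fun e => (RR A e).card) A.card σ hs0
      (fun e he => ⟨(mem_filter.1 he).2.2, RR_card_le A e⟩)
    intro i
    apply level_two hA _ (fun d hd => (mem_filter.1 (mem_filter.1 hd).1).2.1) (2 ^ i * σ)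
      (fun d hd => (mem_filter.1 hd).2) y hy hn
    refine hs1.trans ?_
    exact_mod_cast Nat.le_mul_of_pos_left _ (by positivity)
  have hJ := log_bound A.card y hy hn
  have hG2 : ∑ d ∈ G, ((RR A d).card : ℝ) ^ 2 ≤ 60 * 10 ^ 15 * y ^ 79 := by
    calc _ ≤ _ := hG
      _ ≤ (60 * y) * (10 ^ 15 * y ^ 78) := by gcongr
      _ = _ := by ring
  have hsum : (∑ d ∈ D, ((RR A d).card : ℝ)) ≤ y ^ 72 := by
    rw [← hn2]; exact_mod_cast RR_sum_le A D
  have hall : ∑ d ∈ D, ((RR A d).card : ℝ) ^ 2 ≤ ∑ d ∈ D, ((if d ≠ 0 ∧ σ ≤ (RR A d).card then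
      ((RR A d).card : ℝ) ^ 2 else 0) + σ * (RR A d).card + if d = 0 then y ^ 72 else 0) := by
    refine sum_le_sum (fun d _ => ?_)
    have hp : (0:ℝ) ≤ σ * (RR A d).card := by positivity
    by_cases h0 : d = 0
    · have : ((RR A d).card : ℝ) ≤ A.card := by exact_mod_cast RR_card_le A d
      have : ((RR A d).card : ℝ) ^ 2 ≤ y ^ 72 := by rw [← hn2]; gcongr
      simp only [h0, ne_eq, not_true_eq_false, false_and, if_false, if_true]
      rw [h0] at this hp
      linarith
    · by_cases h1 : σ ≤ (RR A d).card
      · simp only [h0, h1, ne_eq, not_false_eq_true, true_and, if_true, if_false]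
        linarith
      · simp only [h0, h1, and_false, if_false]
        have : ((RR A d).card : ℝ) ≤ σ := by exact_mod_cast (not_le.1 h1).le
        nlinarith [(Nat.cast_nonneg (RR A d).card : (0:ℝ) ≤ (RR A d).card)]
  refine hall.trans ?_
  rw [sum_add_distrib, sum_add_distrib, ← mul_sum, ← sum_filter]
  have c1 : ∑ d ∈ D, (if d = 0 then y ^ 72 else 0) ≤ y ^ 72 := by
    rw [sum_ite_eq']
    split_ifs
    · exact le_rfl
    · positivity
  have c2 : σ * ∑ d ∈ D, ((RR A d).card : ℝ) ≤ 2 * y ^ 80 := by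
    calc _ ≤ (2 * y ^ 8) * y ^ 72 := by gcongr
      _ = _ := by ring
  have p72 : y ^ 72 ≤ y ^ 80 := pow_le_pow_right₀ hy (by norm_num)
  have p79 : y ^ 79 ≤ y ^ 80 := pow_le_pow_right₀ hy (by norm_num)
  have q80 : 0 < y ^ 80 := by positivity
  refine (add_le_add (add_le_add hG2 c2) c1).trans ?_
  linarith

theorem energy_le (A : Finset V) :
    _root_.addEnergy 2 (A : Set V) ≤
      ∑ d ∈ (image (fun z : V × V => z.1 - z.2) (A ×ˢ A)), (RR A d).card ^ 2 := by
  have : ∀ d, (RR A d).card ^ 2 = (RR A d ×ˢ RR A d).card := fun d => by rw [card_product, sq]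
  simp only [this]
  rw [← card_sigma]
  set T := (image (fun z : V × V => z.1 - z.2) (A ×ˢ A)).sigma (fun d => RR A d ×ˢ RR A d) with hT
  rw [← Nat.card_eq_finsetCard T]
  unfold _root_.addEnergy
  have hmem : ∀ p : {p : (Fin 2 → V) × (Fin 2 → V) //
      (∀ i, p.1 i ∈ (A : Set V)) ∧ (∀ i, p.2 i ∈ (A : Set V)) ∧ ∑ i, p.1 i = ∑ i, p.2 i},
      (⟨p.1.1 0 - p.1.2 0, (p.1.1 0, p.1.2 1)⟩ : Sigma (fun _ : V => V × V)) ∈ T := by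
    rintro ⟨⟨a, b⟩, h1, h2, h3⟩
    simp only [Fin.sum_univ_two, mem_coe] at h1 h2 h3
    simp only [hT, mem_sigma, mem_image, mem_product, RR, mem_filter, Prod.exists]
    refine ⟨⟨a 0, b 0, ⟨h1 0, h2 0⟩, rfl⟩, ⟨h1 0, ?_⟩, h2 1, ?_⟩
    · have : a 0 - (a 0 - b 0) = b 0 := by abel
      rw [this]; exact h2 0
    · have : b 1 - (a 0 - b 0) = a 1 := by
        have : b 1 - (a 0 - b 0) = (b 0 + b 1) - a 0 := by abel
        rw [this, ← h3]; abel
      rw [this]; exact h1 1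
  apply Nat.card_le_card_of_injective (fun p => (⟨_, hmem p⟩ : T))
  rintro ⟨⟨a, b⟩, h1, h2, h3⟩ ⟨⟨a', b'⟩, h1', h2', h3'⟩ h
  simp only [Subtype.mk.injEq, Sigma.mk.injEq, heq_eq_eq, Prod.mk.injEq] at h
  simp only [Fin.sum_univ_two] at h3 h3'
  obtain ⟨e1, e2, e3⟩ := h
  have e4 : b 0 = b' 0 := by rw [e2] at e1; exact sub_right_injective e1
  have e5 : a 1 = a' 1 := by
    rw [e4, e3, ← h3', e2] at h3
    exact add_left_cancel h3
  simp only [Subtype.mk.injEq, Prod.mk.injEq]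
  constructor
  · ext i; fin_cases i
    · exact e2
    · exact e5
  · ext i; fin_cases i
    · exact e4
    · exact e3

end Final

theorem statement_19 (ε : ℝ) (hε : 0 < ε) :
    ∃ C : ℝ, 0 < C ∧
      ∀ A : Set (Fin 3 → ℝ), A.Finite → A.Nonempty → A ⊆ realSphere 3 1 →
        (addEnergy 2 A : ℝ) ≤ C * (A.ncard : ℝ) ^ (2 + (2 : ℝ) / 9 + ε) := by
  classical
  refine ⟨10 ^ 17, by norm_num, ?_⟩
  intro A hfin hne hsub
  obtain ⟨B, rfl⟩ := hfin.exists_finset_coe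
  have hB : ∀ p ∈ B, p 0 ^ 2 + p 1 ^ 2 + p 2 ^ 2 = 1 := by
    intro p hp
    have h : ∑ i, p i ^ 2 = 1 := hsub (mem_coe.2 hp)
    rwa [Fin.sum_univ_three] at h
  have hG : Geo B := ⟨fun d d' hd hd' h => sphere_P1 B hB d d' hd hd' h,
    fun F hF r hr hrF => sphere_P2 B hB F hF r hr hrF⟩
  rw [Set.ncard_coe_finset]
  have hcard : 1 ≤ B.card := card_pos.2 (coe_nonempty.1 hne)
  have hcard' : (1:ℝ) ≤ B.card := by exact_mod_cast hcard
  have h0 : (0:ℝ) ≤ B.card := by linarith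
  obtain ⟨y, hydef⟩ : ∃ y : ℝ, y = (B.card : ℝ) ^ ((1:ℝ) / 36) := ⟨_, rfl⟩
  have hy : 1 ≤ y := by rw [hydef]; exact Real.one_le_rpow hcard' (by norm_num)
  have hyn : (B.card : ℝ) = y ^ 36 := by
    rw [hydef]
    rw [← Real.rpow_natCast, ← Real.rpow_mul h0]
    norm_num
  have hy80 : y ^ 80 = (B.card : ℝ) ^ ((20:ℝ) / 9) := by
    rw [hydef]
    rw [← Real.rpow_natCast, ← Real.rpow_mul h0]
    norm_num
  have h1 := energy_bound hG (image (fun z : (Fin 3 → ℝ) × (Fin 3 → ℝ) => z.1 - z.2) (B ×ˢ B)) y hy hyn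
  have h2 : (_root_.addEnergy 2 (B : Set (Fin 3 → ℝ)) : ℝ) ≤
      ∑ d ∈ (image (fun z : (Fin 3 → ℝ) × (Fin 3 → ℝ) => z.1 - z.2) (B ×ˢ B)), ((RR B d).card : ℝ) ^ 2 := by
    exact_mod_cast energy_le B
  refine h2.trans (h1.trans ?_)
  rw [hy80]
  refine mul_le_mul_of_nonneg_left ?_ (by norm_num)
  exact Real.rpow_le_rpow_of_exponent_le hcard' (by linarith)
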